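/- There exists an absolute constant C > 0 with the following property: for every prime p and every nonprincipal Dirichlet character χ modulo p, if every zero s of the Dirichlet L-function L(s,χ) with 0 < Re(s) < 1 satisfies Re(s) = 1/2, then for all real x ≥ 2 one has | ∑_{q ≤ x, q prime} χ(q) | ≤ C · x^{1/2} · (log(p·x))². -/

import Mathlib

section VerticalLines

open Complex MeasureTheory Filter Topology Set

theorem integrable_one_add_abs_rpow_neg_three_halves :
    Integrable fun t : ℝ ↦ (1 + |t|) ^ (-(3 / 2) : ℝ) := by
  simpa using integrable_one_add_norm (E := ℝ) (μ := volume) (r := 3 / 2) (by norm_num)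

theorem one_add_norm_rpow_le_one_add_abs_im (s : ℂ) :
    (1 + ‖s‖) ^ (-(3 / 2) : ℝ) ≤ (1 + |s.im|) ^ (-(3 / 2) : ℝ) :=
  Real.rpow_le_rpow_of_nonpos (by positivity) (by gcongr; exact abs_im_le_norm s) (by norm_num)

/-- Along a vertical line the decay `(1 + ‖s‖)^(-3/2)` yields integrability. -/
theorem integrable_vertical_of_decay {F : ℂ → ℂ} {σ C : ℝ}
    (hF : Continuous fun t : ℝ ↦ F (σ + t * I))
    (hb : ∀ t : ℝ, ‖F (σ + t * I)‖ ≤ C * (1 + ‖(σ + t * I : ℂ)‖) ^ (-(3 / 2) : ℝ)) :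
    Integrable fun t : ℝ ↦ F (σ + t * I) := by
  have hC : 0 ≤ C := nonneg_of_mul_nonneg_left ((norm_nonneg _).trans (hb 0)) (by positivity)
  refine (integrable_one_add_abs_rpow_neg_three_halves.const_mul C).mono'
    hF.aestronglyMeasurable (.of_forall fun t ↦ (hb t).trans ?_)
  simpa using mul_le_mul_of_nonneg_left (one_add_norm_rpow_le_one_add_abs_im (σ + t * I)) hC

theorem continuous_vertical {F : ℂ → ℂ} {σ c : ℝ}
    (hF : DifferentiableOn ℂ F {s | σ ≤ s.re}) (hc : σ ≤ c) :
    Continuous fun t : ℝ ↦ F (c + t * I) :=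
  hF.continuousOn.comp_continuous (by fun_prop) (fun t ↦ by simpa using hc)

theorem tendsto_rpow_neg_three_halves {l : Filter ℝ} {u : ℝ → ℝ} (hu : Tendsto u l atTop) :
    Tendsto (fun t ↦ (1 + u t) ^ (-(3 / 2) : ℝ)) l (𝓝 0) :=
  (tendsto_rpow_neg_atTop (by norm_num)).comp (tendsto_atTop_add_const_left _ _ hu)

/-- Moving a vertical line of integration to the right. -/
theorem integral_vertical_eq_of_decay {F : ℂ → ℂ} {σ c C : ℝ} (hc : σ ≤ c)
    (hF : DifferentiableOn ℂ F {s | σ ≤ s.re})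
    (hb : ∀ s : ℂ, σ ≤ s.re → s.re ≤ c → ‖F s‖ ≤ C * (1 + ‖s‖) ^ (-(3 / 2) : ℝ)) :
    ∫ t : ℝ, F (σ + t * I) = ∫ t : ℝ, F (c + t * I) := by
  have hC : 0 ≤ C :=
    nonneg_of_mul_nonneg_left ((norm_nonneg _).trans (hb σ (by simp) (by simpa using hc))) (by positivity)
  have hint {b : ℝ} (h : σ ≤ b) (h' : b ≤ c) : Integrable fun t : ℝ ↦ F (b + t * I) :=
    integrable_vertical_of_decay (continuous_vertical hF h) fun t ↦ hb _ (by simpa using h) (by simpa using h')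
  have hlim {b : ℝ} (h : σ ≤ b) (h' : b ≤ c) : Tendsto (fun T : ℝ ↦ ∫ t in (-T)..T, F (b + t * I)) atTop
      (𝓝 (∫ t : ℝ, F (b + t * I))) :=
    intervalIntegral_tendsto_integral (hint h h') tendsto_neg_atTop_atBot tendsto_id
  have hhor (e : ℝ) (he : |e| = 1) :
      Tendsto (fun T : ℝ ↦ ∫ r in σ..c, F (r + (e * T : ℝ) * I)) atTop (𝓝 0) := by
    refine squeeze_zero_norm' (a := fun T ↦ C * (1 + T) ^ (-(3 / 2) : ℝ) * |c - σ|) ?_ ?_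
    · filter_upwards [eventually_ge_atTop 0] with T hT
      refine intervalIntegral.norm_integral_le_of_norm_le_const fun r hr ↦ ?_
      rw [uIoc_of_le hc] at hr
      refine (hb _ (by simpa using hr.1.le) (by simpa using hr.2)).trans ?_
      refine mul_le_mul_of_nonneg_left ?_ hC
      refine (one_add_norm_rpow_le_one_add_abs_im _).trans_eq ?_
      simp [abs_mul, he, abs_of_nonneg hT]
    · simpa using ((tendsto_rpow_neg_three_halves tendsto_id).const_mul C).mul_const |c - σ|
  have hrect (T : ℝ) : (∫ r in σ..c, F (r + ((-1 : ℝ) * T : ℝ) * I)) -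
      (∫ r in σ..c, F (r + ((1 : ℝ) * T : ℝ) * I)) + I * (∫ t in (-T)..T, F (c + t * I)) -
      I * (∫ t in (-T)..T, F (σ + t * I)) = 0 := by
    have := integral_boundary_rect_eq_zero_of_differentiableOn F (⟨σ, -T⟩ : ℂ) ⟨c, T⟩
      (hF.mono fun s hs ↦ by
        have := hs.1
        rw [mem_preimage, uIcc_of_le hc] at this
        exact this.1)
    simpa using this
  have h0 := (((hhor (-1) (by simp)).sub (hhor 1 (by simp))).add ((hlim hc le_rfl).const_mul I)).sub
    ((hlim le_rfl hc).const_mul I)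
  simp only [hrect] at h0
  have h1 := tendsto_nhds_unique h0 tendsto_const_nhds
  have h2 : I * ((∫ t : ℝ, F (c + t * I)) - ∫ t : ℝ, F (σ + t * I)) = 0 := by
    rw [mul_sub]; simpa using h1
  have := (mul_eq_zero.mp h2).resolve_left I_ne_zero
  exact (sub_eq_zero.mp this).symm

/-- A holomorphic function decaying in a closed right half-plane has vanishing integral along its
boundary. -/
theorem integral_vertical_eq_zero_of_decay {F : ℂ → ℂ} {σ C : ℝ}
    (hF : DifferentiableOn ℂ F {s | σ ≤ s.re})
    (hb : ∀ s : ℂ, σ ≤ s.re → ‖F s‖ ≤ C * (1 + ‖s‖) ^ (-(3 / 2) : ℝ)) :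
    ∫ t : ℝ, F (σ + t * I) = 0 := by
  have hC : 0 ≤ C :=
    nonneg_of_mul_nonneg_left ((norm_nonneg _).trans (hb σ (by simp))) (by positivity)
  have hlim : Tendsto (fun c : ℝ ↦ ∫ t : ℝ, F (c + t * I)) atTop (𝓝 (∫ _ : ℝ, (0 : ℂ))) := by
    refine tendsto_integral_filter_of_dominated_convergence
      (fun t ↦ C * (1 + |t|) ^ (-(3 / 2) : ℝ)) ?_ ?_
      (integrable_one_add_abs_rpow_neg_three_halves.const_mul C) (.of_forall fun t ↦ ?_)
    · filter_upwards [eventually_ge_atTop σ] with c hc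
      exact (continuous_vertical hF hc).aestronglyMeasurable
    · filter_upwards [eventually_ge_atTop σ] with c hc
      refine .of_forall fun t ↦ (hb _ (by simpa using hc)).trans ?_
      simpa using mul_le_mul_of_nonneg_left (one_add_norm_rpow_le_one_add_abs_im (c + t * I)) hC
    · refine squeeze_zero_norm' (a := fun c ↦ C * (1 + c) ^ (-(3 / 2) : ℝ)) ?_ ?_
      · filter_upwards [eventually_ge_atTop σ, eventually_ge_atTop 0] with c hc hc0
        refine (hb _ (by simpa using hc)).trans ?_
        gcongr ?_ * ?_
        refine Real.rpow_le_rpow_of_nonpos (by positivity) ?_ (by norm_num)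
        gcongr
        simpa using re_le_norm (c + t * I)
      · simpa using (tendsto_rpow_neg_three_halves tendsto_id).const_mul C
  rw [integral_zero] at hlim
  refine tendsto_nhds_unique (tendsto_const_nhds.congr' ?_) hlim
  filter_upwards [eventually_ge_atTop σ] with c hc
  exact integral_vertical_eq_of_decay hc hF fun s hs _ ↦ hb s hs

theorem one_add_norm_le_mul_norm_sub {s w : ℂ} {r : ℝ} (hr : 0 < r) (h : r ≤ ‖s - w‖) :
    1 + ‖s‖ ≤ ((1 + ‖w‖) / r + 1) * ‖s - w‖ := by
  have h1 : ‖s‖ ≤ ‖s - w‖ + ‖w‖ := norm_le_norm_sub_add s w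
  have h2 : 1 + ‖w‖ ≤ (1 + ‖w‖) / r * ‖s - w‖ := by
    rw [div_mul_eq_mul_div, le_div_iff₀ hr]; gcongr
  linarith

theorem norm_inv_sub_le {s w : ℂ} {r : ℝ} (hr : 0 < r) (h : r ≤ ‖s - w‖) :
    ‖(s - w)⁻¹‖ ≤ ((1 + ‖w‖) / r + 1) * (1 + ‖s‖)⁻¹ := by
  have := one_add_norm_le_mul_norm_sub hr h
  rw [norm_inv, ← div_eq_mul_inv, le_div_iff₀ (by positivity), inv_mul_le_iff₀ (hr.trans_le h),
    mul_comm]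
  exact this

/-- Divided differences of a function growing like `‖s‖^(1/2)` decay like `‖s‖^(-1/2)`. -/
theorem exists_norm_dslope_le {f : ℂ → ℂ} {S : Set ℂ} {C r : ℝ} {w : ℂ} (hr : 0 < r)
    (hf : DifferentiableOn ℂ f S) (hball : Metric.closedBall w r ⊆ S) (hC : 0 ≤ C)
    (hb : ∀ s ∈ S, ‖f s‖ ≤ C * (1 + ‖s‖) ^ (1 / 2 : ℝ)) :
    ∃ D, 0 ≤ D ∧ ∀ s ∈ S, ‖dslope f w s‖ ≤ D * (1 + ‖s‖) ^ (-(1 / 2) : ℝ) := by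
  have hS : S ∈ 𝓝 w := mem_of_superset (Metric.closedBall_mem_nhds w hr) hball
  have hd := (differentiableOn_dslope hS).mpr hf
  have hw : w ∈ S := hball (by simp [hr.le])
  obtain ⟨D₀, hD₀⟩ := (isCompact_closedBall w r).exists_bound_of_continuousOn
    (hd.continuousOn.mono hball)
  have hpos : 0 ≤ D₀ := (norm_nonneg _).trans (hD₀ w (by simp [hr.le]))
  set K := (1 + ‖w‖) / r + 1
  have hK : 0 ≤ K := by positivity
  refine ⟨D₀ * (1 + ‖w‖ + r) ^ (1 / 2 : ℝ) + (C + ‖f w‖) * K, by positivity, fun s hs ↦ ?_⟩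
  have h1 : 0 < 1 + ‖s‖ := by positivity
  by_cases hsw : s ∈ Metric.closedBall w r
  · have h2 : ‖s‖ ≤ ‖w‖ + r := by
      have h3 := norm_le_norm_sub_add s w
      rw [mem_closedBall_iff_norm] at hsw
      linarith
    have h3 : 1 ≤ (1 + ‖w‖ + r) ^ (1 / 2 : ℝ) * (1 + ‖s‖) ^ (-(1 / 2) : ℝ) := by
      rw [Real.rpow_neg h1.le, ← div_eq_mul_inv, one_le_div (by positivity)]
      exact Real.rpow_le_rpow h1.le (by linarith) (by norm_num)
    calc ‖dslope f w s‖ ≤ D₀ * 1 := by simpa using hD₀ s hsw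
      _ ≤ D₀ * ((1 + ‖w‖ + r) ^ (1 / 2 : ℝ) * (1 + ‖s‖) ^ (-(1 / 2) : ℝ)) := by gcongr
      _ ≤ _ := by
        rw [add_mul, ← mul_assoc]
        exact le_add_of_nonneg_right (by positivity)
  · rw [mem_closedBall_iff_norm, not_le] at hsw
    have hne : s ≠ w := by rintro rfl; simp at hsw; linarith
    have hone : 1 ≤ (1 + ‖s‖) ^ (1 / 2 : ℝ) :=
      Real.one_le_rpow (by linarith [norm_nonneg s]) (by norm_num)
    have h4 : ‖f s - f w‖ ≤ (C + ‖f w‖) * (1 + ‖s‖) ^ (1 / 2 : ℝ) := by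
      refine (norm_sub_le _ _).trans ?_
      rw [add_mul]
      exact add_le_add (hb s hs) (le_mul_of_one_le_right (norm_nonneg _) hone)
    have h5 : (1 + ‖s‖) ^ (1 / 2 : ℝ) * (1 + ‖s‖)⁻¹ = (1 + ‖s‖) ^ (-(1 / 2) : ℝ) := by
      rw [← Real.rpow_neg_one, ← Real.rpow_add h1]; norm_num
    rw [dslope_of_ne _ hne, slope_def_field, div_eq_mul_inv, norm_mul]
    calc ‖f s - f w‖ * ‖(s - w)⁻¹‖
        ≤ ((C + ‖f w‖) * (1 + ‖s‖) ^ (1 / 2 : ℝ)) * (K * (1 + ‖s‖)⁻¹) := by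
          gcongr
          exact norm_inv_sub_le hr hsw.le
      _ = (C + ‖f w‖) * K * ((1 + ‖s‖) ^ (1 / 2 : ℝ) * (1 + ‖s‖)⁻¹) := by ring
      _ ≤ _ := by
        rw [h5, add_mul]
        have : 0 ≤ D₀ * (1 + ‖w‖ + r) ^ (1 / 2 : ℝ) * (1 + ‖s‖) ^ (-(1 / 2) : ℝ) := by positivity
        linarith

/-- The Poisson kernel of a half-plane at distance `a` from its boundary. -/
noncomputable def halfPlanePoisson (a t : ℝ) : ℝ := 2 * a / (a ^ 2 + t ^ 2)

theorem halfPlanePoisson_nonneg {a : ℝ} (ha : 0 < a) (t : ℝ) : 0 ≤ halfPlanePoisson a t := by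
  unfold halfPlanePoisson; positivity

theorem continuous_halfPlanePoisson {a : ℝ} (ha : 0 < a) : Continuous (halfPlanePoisson a) := by
  unfold halfPlanePoisson
  exact continuous_const.div (by fun_prop) fun t ↦ by positivity

theorem halfPlanePoisson_eq {a : ℝ} (ha : 0 < a) (t : ℝ) :
    halfPlanePoisson a t = 2 / a * (1 + (a⁻¹ * t) ^ 2)⁻¹ := by
  unfold halfPlanePoisson; field_simp

theorem integrable_halfPlanePoisson {a : ℝ} (ha : 0 < a) : Integrable (halfPlanePoisson a) := by
  simp_rw [funext (halfPlanePoisson_eq ha)]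
  exact (integrable_inv_one_add_sq.comp_mul_left' (inv_ne_zero ha.ne')).const_mul _

theorem integral_halfPlanePoisson {a : ℝ} (ha : 0 < a) : ∫ t, halfPlanePoisson a t = 2 * Real.pi := by
  simp_rw [halfPlanePoisson_eq ha, integral_const_mul]
  rw [Measure.integral_comp_mul_left (fun t : ℝ ↦ (1 + t ^ 2)⁻¹) a⁻¹,
    integral_univ_inv_one_add_sq]
  simp [abs_of_pos ha]
  field_simp

/-- `f(σ + it)` times the Poisson kernel is integrable when `f` grows at most like a square root. -/
theorem integrable_mul_halfPlanePoisson {f : ℂ → ℂ} {σ a C : ℝ} (ha : 0 < a)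
    (hf : DifferentiableOn ℂ f {s | σ ≤ s.re})
    (hb : ∀ s : ℂ, σ ≤ s.re → ‖f s‖ ≤ C * (1 + ‖s‖) ^ (1 / 2 : ℝ)) :
    Integrable fun t : ℝ ↦ f (σ + t * I) * halfPlanePoisson a t := by
  have hC : 0 ≤ C :=
    nonneg_of_mul_nonneg_left ((norm_nonneg _).trans (hb σ (by simp))) (by positivity)
  set K := (1 + ‖((σ - a : ℝ) : ℂ)‖) / a + 1
  have hcts : Continuous fun t : ℝ ↦ f (σ + t * I) * (halfPlanePoisson a t : ℂ) :=
    (continuous_vertical hf le_rfl).mul (continuous_ofReal.comp (continuous_halfPlanePoisson ha))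
  refine (integrable_one_add_abs_rpow_neg_three_halves.const_mul (C * (2 * a * K ^ 2))).mono'
    hcts.aestronglyMeasurable (.of_forall fun t ↦ ?_)
  set s : ℂ := σ + t * I with hs
  have h1 : 0 < 1 + ‖s‖ := by positivity
  have hd : s - (σ - a : ℝ) = a + t * I := by rw [hs]; push_cast; ring
  have hn : ‖(a + t * I : ℂ)‖ ^ 2 = a ^ 2 + t ^ 2 := by
    rw [← normSq_eq_norm_sq, normSq_add_mul_I]
  have hle : a ≤ ‖s - (σ - a : ℝ)‖ := by
    rw [hd]; simpa using re_le_norm (a + t * I)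
  have hP : ‖(halfPlanePoisson a t : ℂ)‖ ≤ 2 * a * (K * (1 + ‖s‖)⁻¹) ^ 2 := by
    have := norm_inv_sub_le ha hle
    rw [norm_real, Real.norm_of_nonneg (halfPlanePoisson_nonneg ha t), halfPlanePoisson, ← hn, ← hd,
      div_eq_mul_inv, ← inv_pow, ← norm_inv]
    gcongr
  have hrp : (1 + ‖s‖) ^ (1 / 2 : ℝ) * ((1 + ‖s‖)⁻¹) ^ 2 = (1 + ‖s‖) ^ (-(3 / 2) : ℝ) := by
    rw [inv_pow, ← Real.rpow_natCast, ← Real.rpow_neg h1.le, ← Real.rpow_add h1]; norm_num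
  rw [norm_mul]
  calc ‖f s‖ * ‖(halfPlanePoisson a t : ℂ)‖
      ≤ (C * (1 + ‖s‖) ^ (1 / 2 : ℝ)) * (2 * a * (K * (1 + ‖s‖)⁻¹) ^ 2) := by
        gcongr
        exact hb s (by simp [hs])
    _ = C * (2 * a * K ^ 2) * ((1 + ‖s‖) ^ (1 / 2 : ℝ) * ((1 + ‖s‖)⁻¹) ^ 2) := by ring
    _ ≤ _ := by
      rw [hrp]
      refine mul_le_mul_of_nonneg_left ?_ (by positivity)
      simpa [hs] using one_add_norm_rpow_le_one_add_abs_im s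

/-- Poisson's formula for a half-plane, at a point at height zero. -/
theorem integral_mul_halfPlanePoisson {f : ℂ → ℂ} {σ a C : ℝ} (ha : 0 < a)
    (hf : DifferentiableOn ℂ f {s | σ ≤ s.re})
    (hb : ∀ s : ℂ, σ ≤ s.re → ‖f s‖ ≤ C * (1 + ‖s‖) ^ (1 / 2 : ℝ)) :
    ∫ t : ℝ, f (σ + t * I) * halfPlanePoisson a t = 2 * Real.pi * f (σ + a) := by
  have hC : 0 ≤ C :=
    nonneg_of_mul_nonneg_left ((norm_nonneg _).trans (hb σ (by simp))) (by positivity)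
  set w : ℂ := σ + a with hw
  set v : ℂ := ((σ - a : ℝ) : ℂ) with hv
  have hball : Metric.closedBall w (a / 2) ⊆ {s : ℂ | σ ≤ s.re} := by
    intro s hs
    rw [mem_closedBall_iff_norm] at hs
    have := (abs_re_le_norm (s - w)).trans hs
    simp only [hw, sub_re, add_re, ofReal_re, abs_le] at this
    simp only [Set.mem_ofPred_eq]
    linarith [this.1]
  obtain ⟨D, hD, hDb⟩ := exists_norm_dslope_le (half_pos ha) hf hball hC hb
  have hd : DifferentiableOn ℂ (dslope f w) {s | σ ≤ s.re} :=
    (differentiableOn_dslope (mem_of_superset (Metric.closedBall_mem_nhds w (half_pos ha))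
      hball)).mpr hf
  have hle {s : ℂ} (hs : σ ≤ s.re) : a ≤ ‖s - v‖ := by
    refine le_trans ?_ (re_le_norm (s - v))
    simp [hv]; linarith
  set F : ℂ → ℂ := fun s ↦ dslope f w s * (s - v)⁻¹ with hF
  have hFd : DifferentiableOn ℂ F {s | σ ≤ s.re} :=
    hd.mul ((differentiableOn_id.sub_const v).inv fun s hs ↦
      norm_pos_iff.mp (ha.trans_le (hle hs)))
  have h0 := integral_vertical_eq_zero_of_decay (C := D * ((1 + ‖v‖) / a + 1)) hFd
    (fun s hs ↦ by
      have h1 : 0 < 1 + ‖s‖ := by positivity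
      have hrp : (1 + ‖s‖) ^ (-(1 / 2) : ℝ) * (1 + ‖s‖)⁻¹ = (1 + ‖s‖) ^ (-(3 / 2) : ℝ) := by
        rw [← Real.rpow_neg_one, ← Real.rpow_add h1]; norm_num
      rw [hF, norm_mul, ← hrp]
      calc _ ≤ (D * (1 + ‖s‖) ^ (-(1 / 2) : ℝ)) * (((1 + ‖v‖) / a + 1) * (1 + ‖s‖)⁻¹) := by
            gcongr
            · exact hDb s hs
            · exact norm_inv_sub_le ha (hle hs)
        _ = _ := by ring)
  have hval (t : ℝ) : F (σ + t * I) =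
      (-(2 * a : ℂ)⁻¹) * (f (σ + t * I) * halfPlanePoisson a t - f w * halfPlanePoisson a t) := by
    have hn1 : (-a + t * I : ℂ) ≠ 0 := fun h ↦ ha.ne' (by simpa using congrArg re h)
    have hn2 : (a + t * I : ℂ) ≠ 0 := fun h ↦ ha.ne' (by simpa using congrArg re h)
    have e1 : (σ + t * I - w : ℂ) = -a + t * I := by rw [hw]; ring
    have e2 : (σ + t * I - v : ℂ) = a + t * I := by rw [hv]; push_cast; ring
    have hsw : (σ + t * I : ℂ) ≠ w := by rw [← sub_ne_zero, e1]; exact hn1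
    have e3 : (a ^ 2 + t ^ 2 : ℂ) = -((-a + t * I) * (a + t * I)) := by
      linear_combination (t : ℂ) ^ 2 * I_sq
    have ha' : (a : ℂ) ≠ 0 := mod_cast ha.ne'
    simp only [hF, halfPlanePoisson]
    rw [dslope_of_ne _ hsw, slope_def_field, e1, e2]
    push_cast
    rw [e3]
    field_simp
    ring
  have hi1 := integrable_mul_halfPlanePoisson ha hf hb
  have hi2 : Integrable fun t : ℝ ↦ f w * (halfPlanePoisson a t : ℂ) :=
    (integrable_halfPlanePoisson ha).ofReal.const_mul _
  simp_rw [hval] at h0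
  rw [integral_const_mul, integral_sub hi1 hi2, integral_const_mul, integral_complex_ofReal,
    integral_halfPlanePoisson ha] at h0
  have := (mul_eq_zero.mp h0).resolve_left (by simp [ha.ne'])
  rw [sub_eq_zero.mp this]
  push_cast
  ring

theorem integrable_log_mul_halfPlanePoisson_one :
    Integrable fun t : ℝ ↦ Real.log (1 + |t|) * halfPlanePoisson 1 t := by
  refine (integrable_one_add_abs_rpow_neg_three_halves.const_mul 8).mono'
    (Continuous.aestronglyMeasurable ?_) (.of_forall fun t ↦ ?_)
  · exact (Continuous.log (by fun_prop) fun t ↦ by positivity).mul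
      (continuous_halfPlanePoisson one_pos)
  · have h1 : 0 < 1 + |t| := by positivity
    have hlog : 0 ≤ Real.log (1 + |t|) := Real.log_nonneg (by linarith [abs_nonneg t])
    have h2 : Real.log (1 + |t|) ≤ 2 * (1 + |t|) ^ (1 / 2 : ℝ) := by
      have := Real.log_le_rpow_div h1.le (show (0 : ℝ) < 1 / 2 by norm_num)
      linarith
    have h3 : halfPlanePoisson 1 t ≤ 4 * (1 + |t|) ^ (-2 : ℝ) := by
      rw [Real.rpow_neg h1.le, halfPlanePoisson, ← div_eq_mul_inv, Real.rpow_two,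
        div_le_div_iff₀ (by positivity) (by positivity)]
      nlinarith [sq_nonneg (1 - |t|), sq_abs t]
    rw [Real.norm_of_nonneg (mul_nonneg hlog (halfPlanePoisson_nonneg one_pos t))]
    calc _ ≤ (2 * (1 + |t|) ^ (1 / 2 : ℝ)) * (4 * (1 + |t|) ^ (-2 : ℝ)) := by
          gcongr
          exact halfPlanePoisson_nonneg one_pos t
      _ = 8 * ((1 + |t|) ^ (1 / 2 : ℝ) * (1 + |t|) ^ (-2 : ℝ)) := by ring
      _ = _ := by rw [← Real.rpow_add h1]; norm_num

theorem halfPlanePoisson_eq_scaled {a : ℝ} (ha : 0 < a) (t : ℝ) :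
    halfPlanePoisson a t = a⁻¹ * halfPlanePoisson 1 (a⁻¹ * t) := by
  unfold halfPlanePoisson; field_simp

/-- A function on a half-plane whose real part is at most logarithmic has real part of logarithmic
size on Poisson average. -/
theorem integral_abs_re_mul_halfPlanePoisson_le {f : ℂ → ℂ} {σ a C K B : ℝ} (ha : 1 ≤ a)
    (hK : 1 ≤ K) (hf : DifferentiableOn ℂ f {s | σ ≤ s.re})
    (hb : ∀ s : ℂ, σ ≤ s.re → ‖f s‖ ≤ C * (1 + ‖s‖) ^ (1 / 2 : ℝ))
    (hre : ∀ t : ℝ, (f (σ + t * I)).re ≤ Real.log (K * (1 + |t|))) (hB : ‖f (σ + a)‖ ≤ B) :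
    Integrable (fun t : ℝ ↦ |(f (σ + t * I)).re| * halfPlanePoisson a t) ∧
    ∫ t : ℝ, |(f (σ + t * I)).re| * halfPlanePoisson a t ≤
      4 * Real.pi * Real.log (K * (1 + a)) +
        2 * (∫ t : ℝ, Real.log (1 + |t|) * halfPlanePoisson 1 t) + 2 * Real.pi * B := by
  have ha0 : 0 < a := by linarith
  have hi := integrable_mul_halfPlanePoisson ha0 hf hb
  have hire : Integrable fun t : ℝ ↦ (f (σ + t * I)).re * halfPlanePoisson a t := by
    simpa using hi.re
  have hPoisson : ∫ t : ℝ, (f (σ + t * I)).re * halfPlanePoisson a t =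
      2 * Real.pi * (f (σ + a)).re := by
    have h := integral_re hi
    rw [integral_mul_halfPlanePoisson ha0 hf hb] at h
    simpa using h
  have hlogi : Integrable fun t : ℝ ↦ Real.log (1 + |a⁻¹ * t|) * halfPlanePoisson a t := by
    have := (integrable_log_mul_halfPlanePoisson_one.comp_mul_left' (inv_ne_zero ha0.ne')).const_mul
      a⁻¹
    refine this.congr (.of_forall fun t ↦ ?_)
    simp only [halfPlanePoisson_eq_scaled ha0 t]
    ring
  have hlog : ∫ t : ℝ, Real.log (1 + |a⁻¹ * t|) * halfPlanePoisson a t =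
      ∫ t : ℝ, Real.log (1 + |t|) * halfPlanePoisson 1 t := by
    have := Measure.integral_comp_mul_left
      (fun t : ℝ ↦ Real.log (1 + |t|) * halfPlanePoisson 1 t) a⁻¹
    rw [inv_inv, abs_of_pos ha0, smul_eq_mul] at this
    rw [← inv_mul_cancel_left₀ ha0.ne' (∫ t : ℝ, Real.log (1 + |t|) * halfPlanePoisson 1 t),
      ← this, ← integral_const_mul]
    congr 1 with t
    rw [halfPlanePoisson_eq_scaled ha0 t]
    ring
  have hmaj (t : ℝ) : |(f (σ + t * I)).re| * halfPlanePoisson a t ≤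
      2 * (Real.log (K * (1 + a)) * halfPlanePoisson a t +
        Real.log (1 + |a⁻¹ * t|) * halfPlanePoisson a t) -
        (f (σ + t * I)).re * halfPlanePoisson a t := by
    have h1 : Real.log (K * (1 + |t|)) ≤ Real.log (K * (1 + a)) + Real.log (1 + |a⁻¹ * t|) := by
      rw [← Real.log_mul (by positivity) (by positivity)]
      refine Real.log_le_log (by positivity) ?_
      rw [abs_mul, abs_of_pos (inv_pos.mpr ha0), mul_assoc]
      gcongr
      have h2 : (1 + a) * (1 + a⁻¹ * |t|) = 1 + |t| + a + a⁻¹ * |t| := by field_simp; ring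
      rw [h2]
      have : 0 ≤ a⁻¹ * |t| := by positivity
      linarith
    have h0 : 0 ≤ Real.log (K * (1 + |t|)) :=
      Real.log_nonneg (one_le_mul_of_one_le_of_one_le hK (by linarith [abs_nonneg t]))
    have h3 : |(f (σ + t * I)).re| ≤
        2 * (Real.log (K * (1 + a)) + Real.log (1 + |a⁻¹ * t|)) - (f (σ + t * I)).re := by
      have := hre t
      rw [abs_le]; constructor <;> linarith
    calc _ ≤ (2 * (Real.log (K * (1 + a)) + Real.log (1 + |a⁻¹ * t|)) - (f (σ + t * I)).re) *
          halfPlanePoisson a t :=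
          mul_le_mul_of_nonneg_right h3 (halfPlanePoisson_nonneg ha0 t)
      _ = _ := by ring
  have hconst : Integrable fun t : ℝ ↦ Real.log (K * (1 + a)) * halfPlanePoisson a t :=
    (integrable_halfPlanePoisson ha0).const_mul _
  have habs : Integrable fun t : ℝ ↦ |(f (σ + t * I)).re| * halfPlanePoisson a t := by
    refine hire.abs.congr (.of_forall fun t ↦ ?_)
    simp only [abs_mul, abs_of_nonneg (halfPlanePoisson_nonneg ha0 t)]
  refine ⟨habs, ?_⟩
  have hadd : Integrable fun t : ℝ ↦ Real.log (K * (1 + a)) * halfPlanePoisson a t +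
      Real.log (1 + |a⁻¹ * t|) * halfPlanePoisson a t := hconst.add hlogi
  have hle := integral_mono habs ((hadd.const_mul 2).sub hire) hmaj
  simp only [Pi.sub_apply] at hle
  rw [integral_sub (hadd.const_mul 2) hire, integral_const_mul,
    integral_add hconst hlogi, integral_const_mul, integral_halfPlanePoisson ha0, hlog,
    hPoisson] at hle
  have h5 : -(f (σ + a)).re ≤ B :=
    (neg_le_abs _).trans ((abs_re_le_norm _).trans hB)
  nlinarith [Real.pi_pos]

/-- Perron's formula with the kernel `1 / s ^ 2`. -/
theorem integral_exp_mul_div_sq {c : ℝ} (hc : 0 < c) (u : ℝ) :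
    ∫ t : ℝ, exp (u * (c + t * I)) / (c + t * I) ^ 2 = 2 * Real.pi * (max u 0 : ℝ) := by
  set g : ℝ → ℂ := fun t ↦ Real.log t • indicator (Ioc 0 1) (fun _ ↦ (1 : ℂ)) t with hg
  have hgv {t : ℝ} (ht : 0 < t) : g t = ((-max (-Real.log t) 0 : ℝ) : ℂ) := by
    by_cases h1 : t ≤ 1
    · have : Real.log t ≤ 0 := Real.log_nonpos ht.le h1
      simp [hg, indicator_of_mem (show t ∈ Ioc (0 : ℝ) 1 from ⟨ht, h1⟩), max_eq_left (neg_nonneg.mpr this)]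
    · have : 0 ≤ Real.log t := Real.log_nonneg (not_le.mp h1).le
      have h2 : t ∉ Ioc (0 : ℝ) 1 := fun h ↦ h1 h.2
      simp [hg, indicator_of_notMem h2, max_eq_right (neg_nonpos.mpr this)]
  have hM {s : ℂ} (hs : 0 < s.re) : MellinConvergent g s ∧ mellin g s = -(1 / s ^ 2) := by
    have h := mellin_hasDerivAt_of_isBigO_rpow (E := ℂ) (a := s.re + 1) (b := 0)
      (f := indicator (Ioc 0 1) (fun _ ↦ (1 : ℂ))) (s := s) ?_ ?_ (by linarith) ?_ hs
    · refine ⟨h.1, ?_⟩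
      have hs0 : s ≠ 0 := by rintro rfl; simp at hs
      have h2 : HasDerivAt (mellin (indicator (Ioc 0 1) (fun _ ↦ (1 : ℂ)))) (-(1 / s ^ 2)) s := by
        have h3 := (hasDerivAt_inv hs0)
        rw [← one_div] at h3
        refine h3.congr_of_eventuallyEq ?_
        filter_upwards [(isOpen_lt continuous_const continuous_re).mem_nhds hs] with z hz
        rw [(hasMellin_one_Ioc hz).2, one_div]
      exact h.2.unique h2
    · exact ((integrable_indicator_iff measurableSet_Ioc).mpr
        (integrableOn_const (by simp))).locallyIntegrable.locallyIntegrableOn _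
    · refine (Asymptotics.isBigO_zero _ _).congr' ?_ .rfl
      filter_upwards [eventually_gt_atTop 1] with t ht
      rw [indicator_of_notMem fun h ↦ ht.not_ge h.2]
    · refine Asymptotics.IsBigO.of_bound 1 (.of_forall fun t ↦ ?_)
      by_cases ht : t ∈ Ioc (0 : ℝ) 1 <;> simp [ht]
  have hline (y : ℝ) : 0 < ((c : ℂ) + y * I).re := by simpa using hc
  have hne (y : ℝ) : (c : ℂ) + y * I ≠ 0 := fun h ↦ by simpa [h] using hline y
  have hx := Real.exp_pos (-u)
  have hinv := mellinInv_mellin_eq c g hx (hM (by simpa using hc)).1 ?_ ?_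
  · rw [hgv hx, Real.log_exp, neg_neg, mellinInv] at hinv
    have hpt (y : ℝ) : ((Real.exp (-u) : ℝ) : ℂ) ^ (-((c : ℂ) + y * I)) • mellin g (c + y * I) =
        -(exp (u * (c + y * I)) / (c + y * I) ^ 2) := by
      rw [(hM (hline y)).2, cpow_def_of_ne_zero (by exact_mod_cast hx.ne'), ← ofReal_log hx.le,
        Real.log_exp, smul_eq_mul]
      push_cast
      rw [mul_neg, mul_one_div]
      congr 3
      ring
    simp_rw [hpt] at hinv
    rw [integral_neg, smul_neg, ofReal_neg, neg_inj, real_smul] at hinv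
    rw [← hinv]
    generalize ∫ t : ℝ, exp (u * (c + t * I)) / (c + t * I) ^ 2 = J
    push_cast
    field_simp
  · have hcont : Continuous fun y : ℝ ↦ mellin g (c + y * I) := by
      simp_rw [fun y ↦ (hM (hline y)).2]
      exact (continuous_const.div (by fun_prop) fun y ↦ pow_ne_zero 2 (hne y)).neg
    refine (((integrable_halfPlanePoisson hc).const_mul (1 / (2 * c)))).mono'
      hcont.aestronglyMeasurable (.of_forall fun y ↦ le_of_eq ?_)
    rw [(hM (hline y)).2, norm_neg, norm_div, norm_pow, norm_one, ← normSq_eq_norm_sq,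
      normSq_add_mul_I, halfPlanePoisson]
    field_simp
  · have : ContinuousAt (fun t ↦ ((-max (-Real.log t) 0 : ℝ) : ℂ)) (Real.exp (-u)) := by
      have := Real.continuousAt_log hx.ne'
      fun_prop
    refine this.congr ?_
    filter_upwards [lt_mem_nhds hx] with t ht
    exact (hgv ht).symm

/-- The entire function `(exp (β s) - 1) / s`. -/
noncomputable def expQuot (β : ℝ) (s : ℂ) : ℂ := dslope (fun z ↦ exp (β * z)) 0 s

theorem expQuot_of_ne_zero (β : ℝ) {s : ℂ} (hs : s ≠ 0) : expQuot β s = (exp (β * s) - 1) / s := by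
  rw [expQuot, dslope_of_ne _ hs, slope_def_field]
  simp

theorem differentiable_expQuot (β : ℝ) : Differentiable ℂ (expQuot β) := by
  rw [← differentiableOn_univ]
  exact (differentiableOn_dslope univ_mem).mpr (by fun_prop)

theorem expQuot_conj (β : ℝ) (s : ℂ) :
    expQuot β ((starRingEnd ℂ) s) = (starRingEnd ℂ) (expQuot β s) := by
  have key {s : ℂ} (hs : s ≠ 0) :
      expQuot β ((starRingEnd ℂ) s) = (starRingEnd ℂ) (expQuot β s) := by
    rw [expQuot_of_ne_zero β hs, expQuot_of_ne_zero β ((map_ne_zero _).mpr hs)]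
    simp [← exp_conj]
  have hc := (differentiable_expQuot β).continuous
  refine congr_fun (Continuous.ext_on (s := {0}ᶜ) (dense_compl_singleton 0)
    (hc.comp continuous_conj) (continuous_conj.comp hc) fun z hz ↦ key hz) s

theorem exists_norm_expQuot_le {β : ℝ} (hβ : 0 ≤ β) (b : ℝ) :
    ∃ C, 0 ≤ C ∧ ∀ s : ℂ, s.re ≤ b → ‖expQuot β s‖ ≤ C * (1 + ‖s‖)⁻¹ := by
  obtain ⟨D, hD⟩ := (isCompact_closedBall (0 : ℂ) 1).exists_bound_of_continuousOn
    (differentiable_expQuot β).continuous.continuousOn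
  have hD0 : 0 ≤ D := (norm_nonneg _).trans (hD 0 (by simp))
  refine ⟨2 * (D + (Real.exp (β * b) + 1)), by positivity, fun s hs ↦ ?_⟩
  have h1 : 0 < 1 + ‖s‖ := by positivity
  rw [← div_eq_mul_inv, le_div_iff₀ h1]
  rcases le_or_gt ‖s‖ 1 with h | h
  · have := hD s (by simpa using h)
    have := Real.exp_pos (β * b)
    nlinarith [norm_nonneg (expQuot β s)]
  · have h0 : 0 < ‖s‖ := by linarith
    have h2 : ‖exp (β * s) - 1‖ ≤ Real.exp (β * b) + 1 := by
      refine (norm_sub_le _ _).trans ?_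
      rw [norm_exp, norm_one, re_ofReal_mul]
      gcongr
    rw [expQuot_of_ne_zero β (norm_pos_iff.mp h0), norm_div, div_mul_eq_mul_div, div_le_iff₀ h0]
    have : 0 ≤ Real.exp (β * b) + 1 := by positivity
    calc _ ≤ (Real.exp (β * b) + 1) * (2 * ‖s‖) := by gcongr; linarith
      _ ≤ _ := by nlinarith [mul_nonneg hD0 h0.le]

/-- The Mellin-type transform of the trapezoid weight equal to `1` on `[η, β]` and vanishing
outside `[0, β + η]`. -/
noncomputable def trapezoidKernel (β η : ℝ) (s : ℂ) : ℂ := expQuot β s * expQuot η s / η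

theorem differentiable_trapezoidKernel (β η : ℝ) : Differentiable ℂ (trapezoidKernel β η) :=
  ((differentiable_expQuot β).mul (differentiable_expQuot η)).div_const _

theorem trapezoidKernel_conj (β η : ℝ) (s : ℂ) :
    trapezoidKernel β η ((starRingEnd ℂ) s) = (starRingEnd ℂ) (trapezoidKernel β η s) := by
  simp [trapezoidKernel, expQuot_conj]

theorem trapezoidKernel_of_ne_zero (β η : ℝ) {s : ℂ} (hs : s ≠ 0) :
    trapezoidKernel β η s = (exp (β * s) - 1) * (exp (η * s) - 1) / (η * s ^ 2) := by
  rw [trapezoidKernel, expQuot_of_ne_zero β hs, expQuot_of_ne_zero η hs]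
  field_simp

theorem exists_norm_trapezoidKernel_le {β η : ℝ} (hβ : 0 ≤ β) (hη : 0 ≤ η) (b : ℝ) :
    ∃ C, 0 ≤ C ∧ ∀ s : ℂ, s.re ≤ b → ‖trapezoidKernel β η s‖ ≤ C * (1 + ‖s‖) ^ (-2 : ℝ) := by
  obtain ⟨C, hC, h1⟩ := exists_norm_expQuot_le hβ b
  obtain ⟨D, hD, h2⟩ := exists_norm_expQuot_le hη b
  refine ⟨C * D / η, by positivity, fun s hs ↦ ?_⟩
  have h3 : 0 < 1 + ‖s‖ := by positivity
  rw [trapezoidKernel, norm_div, norm_mul, norm_real, Real.norm_of_nonneg hη,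
    Real.rpow_neg h3.le, Real.rpow_two]
  calc _ ≤ (C * (1 + ‖s‖)⁻¹) * (D * (1 + ‖s‖)⁻¹) / η := by
        gcongr
        exacts [h1 s hs, h2 s hs]
    _ = _ := by field_simp

theorem mul_rpow_neg_two_le {C D u v y : ℝ} (hy : 0 < y) (hC : 0 ≤ C) (hv : 0 ≤ v)
    (h1 : u ≤ C * y ^ (1 / 2 : ℝ)) (h2 : v ≤ D * y ^ (-2 : ℝ)) :
    u * v ≤ C * D * y ^ (-(3 / 2) : ℝ) := by
  calc _ ≤ (C * y ^ (1 / 2 : ℝ)) * (D * y ^ (-2 : ℝ)) :=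
        mul_le_mul h1 h2 hv (by positivity)
    _ = C * D * (y ^ (1 / 2 : ℝ) * y ^ (-2 : ℝ)) := by ring
    _ = _ := by rw [← Real.rpow_add hy]; norm_num

theorem integral_mul_trapezoidKernel_eq_of_le {f : ℂ → ℂ} {σ c C β η : ℝ} (hβ : 0 ≤ β)
    (hη : 0 ≤ η) (hc : σ ≤ c) (hf : DifferentiableOn ℂ f {s | σ ≤ s.re})
    (hb : ∀ s : ℂ, σ ≤ s.re → ‖f s‖ ≤ C * (1 + ‖s‖) ^ (1 / 2 : ℝ)) :
    ∫ t : ℝ, f (σ + t * I) * trapezoidKernel β η (σ + t * I) =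
      ∫ t : ℝ, f (c + t * I) * trapezoidKernel β η (c + t * I) := by
  have hC : 0 ≤ C :=
    nonneg_of_mul_nonneg_left ((norm_nonneg _).trans (hb σ (by simp))) (by positivity)
  obtain ⟨D, hD, h1⟩ := exists_norm_trapezoidKernel_le hβ hη c
  refine integral_vertical_eq_of_decay (F := fun s ↦ f s * trapezoidKernel β η s) (C := C * D) hc
    (hf.mul (differentiable_trapezoidKernel β η).differentiableOn) fun s hs hs' ↦ ?_
  rw [norm_mul]
  exact mul_rpow_neg_two_le (by positivity) hC (norm_nonneg _) (hb s hs) (h1 s hs')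

/-- Only the real part of `f` matters on the left-most line. -/
theorem integral_mul_trapezoidKernel_eq_re {f : ℂ → ℂ} {σ C β η : ℝ} (hβ : 0 ≤ β)
    (hη : 0 ≤ η) (hf : DifferentiableOn ℂ f {s | σ ≤ s.re})
    (hb : ∀ s : ℂ, σ ≤ s.re → ‖f s‖ ≤ C * (1 + ‖s‖) ^ (1 / 2 : ℝ)) :
    ∫ t : ℝ, f (σ + t * I) * trapezoidKernel β η (σ + t * I) =
      ∫ t : ℝ, (2 * (f (σ + t * I)).re : ℝ) * trapezoidKernel β η (σ + t * I) := by
  have hC : 0 ≤ C :=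
    nonneg_of_mul_nonneg_left ((norm_nonneg _).trans (hb σ (by simp))) (by positivity)
  obtain ⟨D, hD, h1⟩ := exists_norm_trapezoidKernel_le hβ hη (max σ 0)
  have hW := differentiable_trapezoidKernel β η
  have hint : Integrable fun t : ℝ ↦ f (σ + t * I) * trapezoidKernel β η (σ + t * I) := by
    refine integrable_vertical_of_decay (F := fun s ↦ f s * trapezoidKernel β η s) (C := C * D)
      (continuous_vertical (hf.mul hW.differentiableOn) le_rfl) fun t ↦ ?_
    rw [norm_mul]
    exact mul_rpow_neg_two_le (by positivity) hC (norm_nonneg _) (hb _ (by simp))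
      (h1 _ (by simp))
  have hline (t : ℝ) : 2 * (σ : ℂ) - (σ + t * I) = (starRingEnd ℂ) (σ + t * I) := by
    simp; ring
  have hcmp (s : ℂ) (hs : σ ≤ s.re) :
      (1 + ‖2 * (σ : ℂ) - s‖) ^ (-2 : ℝ) ≤ (1 + 2 * |σ|) ^ (2 : ℝ) * (1 + ‖s‖) ^ (-2 : ℝ) := by
    have h2 : ‖s‖ ≤ ‖2 * (σ : ℂ) - s‖ + 2 * |σ| := by
      have := norm_sub_le (2 * (σ : ℂ)) (2 * (σ : ℂ) - s)
      simp only [sub_sub_cancel, norm_mul, norm_real, Real.norm_eq_abs, Complex.norm_ofNat] at this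
      linarith
    have h3 : 0 < 1 + ‖s‖ := by positivity
    have h4 : 0 < 1 + ‖2 * (σ : ℂ) - s‖ := by positivity
    rw [Real.rpow_neg h3.le, Real.rpow_neg h4.le, ← div_eq_mul_inv, le_div_iff₀ (by positivity),
      inv_mul_le_iff₀ (by positivity), ← Real.mul_rpow (by positivity) (by positivity)]
    refine Real.rpow_le_rpow h3.le ?_ (by norm_num)
    nlinarith [mul_nonneg (norm_nonneg (2 * (σ : ℂ) - s)) (abs_nonneg σ)]
  have hzero : ∫ t : ℝ, f (σ + t * I) * (starRingEnd ℂ) (trapezoidKernel β η (σ + t * I)) = 0 := by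
    have := integral_vertical_eq_zero_of_decay (σ := σ)
      (F := fun s ↦ f s * trapezoidKernel β η (2 * σ - s))
      (C := C * (D * (1 + 2 * |σ|) ^ (2 : ℝ)))
      (hf.mul (hW.comp (by fun_prop : Differentiable ℂ fun s : ℂ ↦ 2 * (σ : ℂ) - s)).differentiableOn)
      fun s hs ↦ by
        rw [norm_mul]
        refine mul_rpow_neg_two_le (by positivity) hC (norm_nonneg _) (hb s hs)
          ((h1 _ (le_max_of_le_left (by simp; linarith))).trans ?_)
        rw [mul_assoc]
        exact mul_le_mul_of_nonneg_left (hcmp s hs) hD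
    simpa only [hline, trapezoidKernel_conj] using this
  have hconj : Integrable fun t : ℝ ↦
      (starRingEnd ℂ) (f (σ + t * I)) * trapezoidKernel β η (σ + t * I) := by
    refine hint.mono (Continuous.aestronglyMeasurable ?_) (.of_forall fun t ↦ by simp)
    exact (continuous_conj.comp (continuous_vertical hf le_rfl)).mul
      (hW.continuous.comp (by fun_prop))
  have hzero' : ∫ t : ℝ, (starRingEnd ℂ) (f (σ + t * I)) * trapezoidKernel β η (σ + t * I) = 0 := by
    rw [← map_zero (starRingEnd ℂ), ← hzero, ← integral_conj]
    simp
  rw [← add_zero (∫ t : ℝ, f (σ + t * I) * trapezoidKernel β η (σ + t * I)), ← hzero',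
    ← integral_add hint hconj]
  congr 1 with t
  rw [← add_mul, add_conj]

theorem norm_exp_sub_one_le_four {z : ℂ} (hz : z.re ≤ 1) :
    ‖exp z - 1‖ ≤ 4 ∧ ‖exp z - 1‖ ≤ 4 * ‖z‖ := by
  have h4 : ‖exp z - 1‖ ≤ 4 := by
    refine (norm_sub_le _ _).trans ?_
    rw [norm_exp, norm_one]
    have := Real.exp_le_exp.mpr hz
    linarith [Real.exp_one_lt_d9]
  refine ⟨h4, ?_⟩
  rcases le_or_gt ‖z‖ 1 with h | h
  · exact (norm_exp_sub_one_le h).trans (by linarith [norm_nonneg z])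
  · linarith

/-- On the line `Re s = 1/2 + 1/log x`, the trapezoid kernel is dominated by a dyadic sum of Poisson
kernels. -/
theorem norm_trapezoidKernel_le_sum_halfPlanePoisson {x : ℝ} (hx : 2 ≤ x) {J : ℕ}
    (hJ : 2 * √x ≤ 2 ^ J) (t : ℝ) :
    ‖trapezoidKernel (Real.log x) (1 / (2 * √x))
      (((1 / 2 + 1 / Real.log x : ℝ) : ℂ) + t * I)‖ ≤
      40 * √x * ∑ j ∈ Finset.range (J + 1), halfPlanePoisson (2 ^ j) t := by
  set σ := 1 / 2 + 1 / Real.log x with hσ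
  set η := 1 / (2 * √x) with hη
  set s : ℂ := (σ : ℂ) + t * I with hs
  have hlog2 := Real.log_two_gt_d9
  have hlog : 0.69 ≤ Real.log x := by
    have := Real.log_le_log (by norm_num) hx
    linarith
  have hinv : 1 / Real.log x ≤ 3 / 2 := by
    rw [div_le_div_iff₀ (by linarith) (by norm_num)]; linarith
  have hinv0 : 0 < 1 / Real.log x := by apply one_div_pos.mpr; linarith
  have hsq : 1.4 ≤ √x := Real.le_sqrt_of_sq_le (by linarith)
  have hη0 : 0 < η := by positivity
  have hησ : η * σ ≤ 1 := by
    have : η ≤ 1 / 2 := by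
      rw [hη, div_le_div_iff₀ (by linarith) (by norm_num)]; linarith
    nlinarith
  have hre : s.re = σ := by simp [hs]
  have him : s.im = t := by simp [hs]
  have hs_half : 1 / 2 ≤ ‖s‖ := by
    have := re_le_norm s
    rw [hre] at this; linarith
  have hs_t : |t| ≤ ‖s‖ := him ▸ abs_im_le_norm s
  have hs0 : 0 < ‖s‖ := by linarith
  have hβ : ‖exp (Real.log x * s) - 1‖ ≤ 4 * √x := by
    refine (norm_sub_le _ _).trans ?_
    rw [norm_exp, norm_one, re_ofReal_mul, hre, hσ]
    have h1 : Real.log x * (1 / 2 + 1 / Real.log x) = Real.log x * (1 / 2) + 1 := by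
      field_simp
    rw [h1, Real.exp_add, ← Real.rpow_def_of_pos (by linarith), ← Real.sqrt_eq_rpow]
    nlinarith [Real.exp_one_lt_d9]
  have hη4 := norm_exp_sub_one_le_four (z := η * s) (by rwa [re_ofReal_mul, hre])
  rw [norm_mul, norm_real, Real.norm_of_nonneg hη0.le] at hη4
  have hW : ‖trapezoidKernel (Real.log x) η s‖ =
      ‖exp (Real.log x * s) - 1‖ * ‖exp (η * s) - 1‖ / (η * ‖s‖ ^ 2) := by
    rw [trapezoidKernel_of_ne_zero _ _ (norm_pos_iff.mp hs0)]
    simp only [norm_div, norm_mul, norm_pow, norm_real, Real.norm_of_nonneg hη0.le]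
  have hW1 : ‖trapezoidKernel (Real.log x) η s‖ ≤ 16 * √x / ‖s‖ := by
    rw [hW]
    calc _ ≤ (4 * √x) * (4 * (η * ‖s‖)) / (η * ‖s‖ ^ 2) := by gcongr; exact hη4.2
      _ = _ := by field_simp; norm_num
  have hW2 : ‖trapezoidKernel (Real.log x) η s‖ ≤ 16 * √x * (2 * √x) / ‖s‖ ^ 2 := by
    rw [hW]
    calc _ ≤ (4 * √x) * 4 / (η * ‖s‖ ^ 2) := by gcongr; exact hη4.1
      _ = _ := by rw [hη]; field_simp; norm_num
  suffices ∃ j ∈ Finset.range (J + 1),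
      ‖trapezoidKernel (Real.log x) η s‖ ≤ 40 * √x * halfPlanePoisson (2 ^ j) t by
    obtain ⟨j, hj, hle⟩ := this
    refine hle.trans (mul_le_mul_of_nonneg_left ?_ (by positivity))
    exact Finset.single_le_sum (f := fun j ↦ halfPlanePoisson (2 ^ j) t)
      (fun i _ ↦ halfPlanePoisson_nonneg (by positivity) t) hj
  rcases le_or_gt |t| 1 with ht1 | ht1
  · refine ⟨0, by simp, hW1.trans ?_⟩
    rw [halfPlanePoisson, pow_zero, mul_div_assoc', div_le_div_iff₀ hs0 (by positivity)]
    have ht2 : t ^ 2 ≤ 1 := (sq_le_one_iff_abs_le_one t).mpr ht1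
    nlinarith
  rcases le_or_gt (2 ^ J) |t| with htJ | htJ
  · refine ⟨J, by simp, hW2.trans ?_⟩
    have h1 : ‖s‖ ^ 2 ≥ t ^ 2 := by rw [← sq_abs t]; gcongr
    have h2 : ((2 : ℝ) ^ J) ^ 2 ≤ t ^ 2 := by rw [← sq_abs t]; gcongr
    have h3 : 0 < t ^ 2 := lt_of_lt_of_le (by positivity) h2
    rw [halfPlanePoisson, mul_div_assoc', div_le_div_iff₀ (by positivity) (by positivity)]
    have hJ0 : (0 : ℝ) < 2 ^ J := by positivity
    calc 16 * √x * (2 * √x) * ((2 ^ J) ^ 2 + t ^ 2)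
        ≤ 16 * √x * 2 ^ J * (t ^ 2 + t ^ 2) := by gcongr
      _ = 32 * √x * 2 ^ J * t ^ 2 := by ring
      _ ≤ 80 * √x * 2 ^ J * ‖s‖ ^ 2 := by gcongr; norm_num
      _ = _ := by ring
  · obtain ⟨j, hj1, hj2⟩ := exists_nat_pow_near ht1.le (by norm_num : (1 : ℝ) < 2)
    have hjJ : j < J := (pow_lt_pow_iff_right₀ (by norm_num : (1 : ℝ) < 2)).mp (hj1.trans_lt htJ)
    refine ⟨j, by simp; omega, hW1.trans ?_⟩
    have hj0 : (0 : ℝ) < 2 ^ j := by positivity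
    have h2 : t ^ 2 ≤ 4 * (2 ^ j) ^ 2 := by
      rw [← sq_abs t]
      rw [pow_succ] at hj2
      nlinarith [abs_nonneg t]
    rw [halfPlanePoisson, mul_div_assoc', div_le_div_iff₀ hs0 (by positivity)]
    calc 16 * √x * ((2 ^ j) ^ 2 + t ^ 2) ≤ 16 * √x * ((2 ^ j) ^ 2 + 4 * (2 ^ j) ^ 2) := by gcongr
      _ = 80 * √x * 2 ^ j * 2 ^ j := by ring
      _ ≤ 80 * √x * 2 ^ j * ‖s‖ := by gcongr; exact hj1.trans hs_t
      _ = _ := by ring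

/-- The number of dyadic scales needed below is logarithmic. -/
theorem exists_two_pow_near_sqrt {x : ℝ} (hx : 2 ≤ x) :
    ∃ J : ℕ, 2 * √x ≤ 2 ^ J ∧ (2 : ℝ) ^ J ≤ 4 * √x ∧ (J + 1 : ℝ) ≤ 6 * Real.log x := by
  have hlog2 := Real.log_two_gt_d9
  have hlog : Real.log 2 ≤ Real.log x := Real.log_le_log (by norm_num) hx
  have hsq : 1.4 ≤ √x := Real.le_sqrt_of_sq_le (by linarith)
  obtain ⟨n, h1, h2⟩ := exists_nat_pow_near (by linarith : 1 ≤ 2 * √x) (by norm_num : (1 : ℝ) < 2)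
  refine ⟨n + 1, h2.le, by rw [pow_succ]; linarith, ?_⟩
  have h3 := Real.log_le_log (by positivity) h1
  rw [Real.log_pow, Real.log_mul (by norm_num) (by positivity), Real.log_sqrt (by linarith)] at h3
  push_cast
  nlinarith

theorem norm_integral_mul_trapezoidKernel_le {f : ℂ → ℂ} {x C K B : ℝ} (hx : 2 ≤ x) (hK : 2 ≤ K)
    (hf : DifferentiableOn ℂ f {s | 1 / 2 + 1 / Real.log x ≤ s.re})
    (hb : ∀ s : ℂ, 1 / 2 + 1 / Real.log x ≤ s.re → ‖f s‖ ≤ C * (1 + ‖s‖) ^ (1 / 2 : ℝ))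
    (hre : ∀ t : ℝ, (f (((1 / 2 + 1 / Real.log x : ℝ) : ℂ) + t * I)).re ≤
      Real.log (K * (1 + |t|)))
    (hB : ∀ s : ℂ, 3 / 2 ≤ s.re → ‖f s‖ ≤ B) :
    ‖∫ t : ℝ, f (((1 / 2 + 1 / Real.log x : ℝ) : ℂ) + t * I) *
      trapezoidKernel (Real.log x) (1 / (2 * √x))
        (((1 / 2 + 1 / Real.log x : ℝ) : ℂ) + t * I)‖ ≤
      480 * (12 * Real.pi + 2 * (∫ t : ℝ, Real.log (1 + |t|) * halfPlanePoisson 1 t) +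
        2 * Real.pi * B) * √x * Real.log x * Real.log (K * x) := by
  have hlogx : 0 < Real.log x := Real.log_pos (by linarith)
  obtain ⟨J, hJ1, hJ2, hJ3⟩ := exists_two_pow_near_sqrt hx
  set σ := 1 / 2 + 1 / Real.log x with hσ
  set η := 1 / (2 * √x) with hη
  set I₀ := ∫ t : ℝ, Real.log (1 + |t|) * halfPlanePoisson 1 t with hI₀
  have hsq : 0 < √x := Real.sqrt_pos.mpr (by linarith)
  have hσ0 : 1 / 2 ≤ σ := by rw [hσ]; have := one_div_pos.mpr hlogx; linarith
  have hB0 : 0 ≤ B := (norm_nonneg _).trans (hB 2 (by norm_num))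
  have hI0 : 0 ≤ I₀ := integral_nonneg fun t ↦
    mul_nonneg (Real.log_nonneg (by linarith [abs_nonneg t])) (halfPlanePoisson_nonneg one_pos t)
  have hKx : 4 ≤ K * x := by nlinarith
  have hL : 1 ≤ Real.log (K * x) := by
    have := Real.log_le_log (by norm_num) hKx
    rw [show (4 : ℝ) = 2 ^ 2 by norm_num, Real.log_pow] at this
    have := Real.log_two_gt_d9
    push_cast at *
    linarith
  have hpow (j : ℕ) : (1 : ℝ) ≤ 2 ^ j := one_le_pow₀ (by norm_num)
  have hP (j : ℕ) := integral_abs_re_mul_halfPlanePoisson_le (B := B) (hpow j)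
    (by linarith : 1 ≤ K) hf hb hre
    (hB _ (by
      have := hpow j
      rw [add_re, ofReal_re, ofReal_re]; linarith))
  have hPj {j : ℕ} (hj : j ∈ Finset.range (J + 1)) :
      ∫ t : ℝ, |(f (σ + t * I)).re| * halfPlanePoisson (2 ^ j) t ≤
        (12 * Real.pi + 2 * I₀ + 2 * Real.pi * B) * Real.log (K * x) := by
    refine (hP j).2.trans ?_
    have h1 : Real.log (K * (1 + 2 ^ j)) ≤ 3 * Real.log (K * x) := by
      have h2 : Real.log ((K * x) ^ 3) = 3 * Real.log (K * x) := by
        rw [Real.log_pow]; norm_num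
      rw [← h2]
      refine Real.log_le_log (by positivity) ?_
      have h3 : (2 : ℝ) ^ j ≤ 2 ^ J :=
        pow_le_pow_right₀ (by norm_num) (by simpa [Nat.lt_succ_iff] using hj)
      have h4 : √x ≤ x := by
        rw [Real.sqrt_le_left (by linarith)]; nlinarith
      have h5 : 1 + (2 : ℝ) ^ j ≤ 5 * x := by linarith
      calc K * (1 + 2 ^ j) ≤ K * (5 * x) := by gcongr
        _ = 5 * (K * x) := by ring
        _ ≤ (K * x) ^ 2 * (K * x) := by gcongr; nlinarith
        _ = _ := by ring
    have h6 := mul_le_mul_of_nonneg_left h1 (by positivity : 0 ≤ 4 * Real.pi)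
    have h7 := mul_le_mul_of_nonneg_left hL (by positivity : 0 ≤ 2 * I₀ + 2 * Real.pi * B)
    linarith
  rw [integral_mul_trapezoidKernel_eq_re hlogx.le (by positivity) hf hb]
  have hsumi : Integrable fun t : ℝ ↦ 80 * √x * ∑ j ∈ Finset.range (J + 1),
      |(f (σ + t * I)).re| * halfPlanePoisson (2 ^ j) t :=
    (integrable_finsetSum _ fun j _ ↦ (hP j).1).const_mul _
  refine (norm_integral_le_of_norm_le hsumi (.of_forall fun t ↦ ?_)).trans ?_
  · have h1 := norm_trapezoidKernel_le_sum_halfPlanePoisson hx hJ1 t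
    rw [norm_mul, norm_real, Real.norm_eq_abs, abs_mul, abs_two, ← Finset.mul_sum]
    calc _ ≤ 2 * |(f (σ + t * I)).re| *
          (40 * √x * ∑ j ∈ Finset.range (J + 1), halfPlanePoisson (2 ^ j) t) := by gcongr
      _ = _ := by ring
  · rw [integral_const_mul, integral_finsetSum _ fun j _ ↦ (hP j).1]
    have h1 := Finset.sum_le_card_nsmul _ _ _ fun j hj ↦ hPj hj
    rw [Finset.card_range, nsmul_eq_mul] at h1
    push_cast at h1
    calc _ ≤ 80 * √x * ((J + 1) *
          ((12 * Real.pi + 2 * I₀ + 2 * Real.pi * B) * Real.log (K * x))) := by gcongr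
      _ ≤ 80 * √x * ((6 * Real.log x) *
          ((12 * Real.pi + 2 * I₀ + 2 * Real.pi * B) * Real.log (K * x))) := by gcongr
      _ = _ := by ring

theorem integrable_exp_mul_div_sq {c : ℝ} (hc : 0 < c) (u : ℝ) :
    Integrable fun t : ℝ ↦ exp (u * (c + t * I)) / (c + t * I) ^ 2 := by
  have hne (t : ℝ) : (c : ℂ) + t * I ≠ 0 := fun h ↦ by
    have := congrArg re h
    simp at this; linarith
  have hcont : Continuous fun t : ℝ ↦ exp (u * (c + t * I)) / (c + t * I) ^ 2 :=
    Continuous.div (by fun_prop) (by fun_prop) fun t ↦ pow_ne_zero 2 (hne t)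
  refine (((integrable_halfPlanePoisson hc).const_mul (Real.exp (u * c) / (2 * c)))).mono'
    hcont.aestronglyMeasurable (.of_forall fun t ↦ le_of_eq ?_)
  rw [norm_div, norm_pow, norm_exp, ← normSq_eq_norm_sq, normSq_add_mul_I, halfPlanePoisson]
  simp
  field_simp

/-- The trapezoid weight. -/
noncomputable def trapezoid (β η u : ℝ) : ℝ :=
  (max (β + η - u) 0 - max (β - u) 0 - max (η - u) 0 + max (-u) 0) / η

theorem integral_exp_neg_mul_trapezoidKernel {c β η : ℝ} (hc : 0 < c) (u : ℝ) :
    ∫ t : ℝ, exp (-(u * (c + t * I))) * trapezoidKernel β η (c + t * I) =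
      2 * Real.pi * (trapezoid β η u : ℝ) := by
  have hne (t : ℝ) : (c : ℂ) + t * I ≠ 0 := fun h ↦ by
    have := congrArg re h
    simp at this; linarith
  have h1 (t : ℝ) : exp (-(u * (c + t * I))) * trapezoidKernel β η (c + t * I) =
      (exp ((β + η - u : ℝ) * (c + t * I)) / (c + t * I) ^ 2 -
        exp ((β - u : ℝ) * (c + t * I)) / (c + t * I) ^ 2 -
        exp ((η - u : ℝ) * (c + t * I)) / (c + t * I) ^ 2 +
        exp ((-u : ℝ) * (c + t * I)) / (c + t * I) ^ 2) / η := by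
    rw [trapezoidKernel_of_ne_zero _ _ (hne t)]
    have e1 : exp ((β + η - u : ℝ) * (c + t * I)) =
        exp (β * (c + t * I)) * exp (η * (c + t * I)) * exp (-(u * (c + t * I))) := by
      rw [← exp_add, ← exp_add]; push_cast; ring_nf
    have e2 : exp ((β - u : ℝ) * (c + t * I)) =
        exp (β * (c + t * I)) * exp (-(u * (c + t * I))) := by
      rw [← exp_add]; push_cast; ring_nf
    have e3 : exp ((η - u : ℝ) * (c + t * I)) =
        exp (η * (c + t * I)) * exp (-(u * (c + t * I))) := by
      rw [← exp_add]; push_cast; ring_nf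
    have e4 : exp ((-u : ℝ) * (c + t * I)) = exp (-(u * (c + t * I))) := by
      push_cast; ring_nf
    rw [e1, e2, e3, e4, ← sub_div, ← sub_div, ← add_div, div_div, mul_div_assoc', mul_comm (η : ℂ) (_ ^ 2)]
    congr 1
    ring
  have i1 := integrable_exp_mul_div_sq hc (β + η - u)
  have i2 := integrable_exp_mul_div_sq hc (β - u)
  have i3 := integrable_exp_mul_div_sq hc (η - u)
  have i4 := integrable_exp_mul_div_sq hc (-u)
  have i12 := i1.sub i2
  have i123 := i12.sub i3
  simp only [Pi.sub_def] at i12 i123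
  simp_rw [h1]
  rw [integral_div, integral_add i123 i4, integral_sub i12 i3, integral_sub i1 i2,
    integral_exp_mul_div_sq hc, integral_exp_mul_div_sq hc, integral_exp_mul_div_sq hc,
    integral_exp_mul_div_sq hc, trapezoid]
  push_cast
  ring

theorem LSeries_term_eq_mul_exp {a : ℕ → ℂ} (ha : a 0 = 0) (s : ℂ) (n : ℕ) :
    LSeries.term a s n = a n * exp (-(Real.log n * s)) := by
  rcases eq_or_ne n 0 with rfl | hn
  · simp [ha]
  · rw [LSeries.term_of_ne_zero hn, cpow_def_of_ne_zero (by exact_mod_cast hn), div_eq_mul_inv,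
      ← exp_neg, ← ofReal_natCast, ofReal_log (by positivity)]

/-- Smoothed Perron formula. -/
theorem integral_LSeries_mul_trapezoidKernel {a : ℕ → ℂ} (ha : ∀ n, ‖a n‖ ≤ 1) (ha0 : a 0 = 0)
    {c β η : ℝ} (hc : 1 < c) (hβ : 0 ≤ β) (hη : 0 ≤ η) :
    ∫ t : ℝ, LSeries a (c + t * I) * trapezoidKernel β η (c + t * I) =
      2 * Real.pi * ∑' n, a n * (trapezoid β η (Real.log n) : ℝ) := by
  have hc0 : 0 < c := by linarith
  set F : ℕ → ℝ → ℂ := fun n t ↦ LSeries.term a (c + t * I) n * trapezoidKernel β η (c + t * I)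
    with hF
  obtain ⟨D, hD, hD'⟩ := exists_norm_trapezoidKernel_le hβ hη c
  have hWi : Integrable fun t : ℝ ↦ trapezoidKernel β η (c + t * I) := by
    refine integrable_vertical_of_decay (C := D)
      ((differentiable_trapezoidKernel β η).continuous.comp (by fun_prop)) fun t ↦
      (hD' _ (by simp)).trans (mul_le_mul_of_nonneg_left ?_ hD)
    exact Real.rpow_le_rpow_of_exponent_le (by linarith [norm_nonneg ((c : ℂ) + t * I)])
      (by norm_num)
  have hterm (n : ℕ) (t : ℝ) : ‖LSeries.term a (c + t * I) n‖ ≤ 1 / (n : ℝ) ^ c := by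
    rw [LSeries.norm_term_eq]
    split_ifs with h
    · positivity
    · simp only [add_re, ofReal_re, mul_re, I_re, mul_zero, ofReal_im, I_im, mul_one, sub_self,
        add_zero]
      gcongr
      exact ha n
  have hFle (n : ℕ) (t : ℝ) :
      ‖F n t‖ ≤ 1 / (n : ℝ) ^ c * ‖trapezoidKernel β η (c + t * I)‖ := by
    rw [hF, norm_mul]
    exact mul_le_mul_of_nonneg_right (hterm n t) (norm_nonneg _)
  have hFi (n : ℕ) : Integrable (F n) := by
    refine (hWi.norm.const_mul (1 / (n : ℝ) ^ c)).mono' (Continuous.aestronglyMeasurable ?_)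
      (.of_forall (hFle n))
    simp only [hF, LSeries_term_eq_mul_exp ha0]
    exact Continuous.mul (by fun_prop)
      ((differentiable_trapezoidKernel β η).continuous.comp (by fun_prop))
  have hsum : Summable fun n ↦ ∫ t, ‖F n t‖ := by
    refine .of_nonneg_of_le (fun n ↦ integral_nonneg fun t ↦ norm_nonneg _) (fun n ↦ ?_)
      ((Real.summable_one_div_nat_rpow.mpr hc).mul_right
        (∫ t : ℝ, ‖trapezoidKernel β η (c + t * I)‖))
    rw [← integral_const_mul]
    exact integral_mono (hFi n).norm (hWi.norm.const_mul _) (hFle n)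
  have hswap := integral_tsum_of_summable_integral_norm hFi hsum
  simp only [hF, LSeries, ← tsum_mul_right] at hswap ⊢
  rw [← hswap, ← tsum_mul_left]
  congr 1 with n
  simp_rw [LSeries_term_eq_mul_exp ha0, mul_assoc]
  rw [integral_const_mul, integral_exp_neg_mul_trapezoidKernel hc0]
  ring

theorem trapezoid_nonneg_le_one {β η u : ℝ} (hη : 0 < η) (hu : η ≤ u) :
    0 ≤ trapezoid β η u ∧ trapezoid β η u ≤ 1 ∧ (u ≤ β → trapezoid β η u = 1) ∧
      (β + η ≤ u → trapezoid β η u = 0) := by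
  have h1 : trapezoid β η u = (max (β + η - u) 0 - max (β - u) 0) / η := by
    rw [trapezoid, max_eq_right (by linarith : η - u ≤ 0), max_eq_right (by linarith : -u ≤ 0)]
    ring
  rw [h1]
  refine ⟨div_nonneg ?_ hη.le, (div_le_one hη).mpr ?_, fun h ↦ ?_, fun h ↦ ?_⟩
  · exact sub_nonneg.mpr (max_le_max_right _ (by linarith))
  · rw [sub_le_iff_le_add]
    refine max_le ?_ (by linarith [le_max_right (β - u) 0])
    linarith [le_max_left (β - u) 0]
  · rw [max_eq_left (by linarith), max_eq_left (by linarith)]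
    field_simp
    ring
  · rw [max_eq_right (by linarith), max_eq_right (by linarith)]
    simp

/-- Replacing the trapezoid weight by a sharp cutoff. -/
theorem norm_sum_sub_tsum_trapezoid_le {a : ℕ → ℂ} (ha : ∀ n, ‖a n‖ ≤ 1) (ha0 : a 0 = 0)
    (ha1 : a 1 = 0) {x : ℝ} (hx : 2 ≤ x) :
    ‖∑ n ∈ Finset.range (⌊x⌋₊ + 1), a n -
      ∑' n, a n * (trapezoid (Real.log x) (1 / (2 * √x)) (Real.log n) : ℝ)‖ ≤ √x + 1 := by
  set η := 1 / (2 * √x) with hη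
  have hsq : 1.4 ≤ √x := Real.le_sqrt_of_sq_le (by linarith)
  have hη0 : 0 < η := by positivity
  have hη1 : η ≤ 1 / 2 := by
    rw [hη, div_le_div_iff₀ (by linarith) (by norm_num)]; linarith
  have hlog {n : ℕ} (hn : 2 ≤ n) : η ≤ Real.log n := by
    have := Real.log_le_log (by norm_num) (by exact_mod_cast hn : (2 : ℝ) ≤ n)
    linarith [Real.log_two_gt_d9]
  have hcases (n : ℕ) : n = 0 ∨ n = 1 ∨ 2 ≤ n := by omega
  set N := ⌊x * Real.exp η⌋₊ with hN
  have hxN : ⌊x⌋₊ ≤ N := Nat.floor_le_floor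
    (le_mul_of_one_le_right (by linarith) (Real.one_le_exp hη0.le))
  have htsum : ∑' n, a n * (trapezoid (Real.log x) η (Real.log n) : ℝ) =
      ∑ n ∈ Finset.range (N + 1), a n * (trapezoid (Real.log x) η (Real.log n) : ℝ) := by
    refine tsum_eq_sum fun n hn ↦ ?_
    obtain rfl | rfl | hn2 := hcases n
    · simp [ha0]
    · simp [ha1]
    have hn3 : x * Real.exp η < n := by
      rw [← Nat.floor_lt (by positivity)]
      simpa [hN, Nat.lt_succ_iff] using hn
    have h4 := Real.log_le_log (by positivity) hn3.le
    rw [Real.log_mul (by positivity) (by positivity), Real.log_exp] at h4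
    rw [(trapezoid_nonneg_le_one hη0 (hlog hn2)).2.2.2 h4]
    simp
  have hlow : ∑ n ∈ Finset.range (⌊x⌋₊ + 1), a n * (trapezoid (Real.log x) η (Real.log n) : ℝ) =
      ∑ n ∈ Finset.range (⌊x⌋₊ + 1), a n := by
    refine Finset.sum_congr rfl fun n hn ↦ ?_
    obtain rfl | rfl | hn2 := hcases n
    · simp [ha0]
    · simp [ha1]
    have hn3 : (n : ℝ) ≤ x :=
      (Nat.le_floor_iff (by linarith)).mp (by simpa [Nat.lt_succ_iff] using hn)
    rw [(trapezoid_nonneg_le_one hη0 (hlog hn2)).2.2.1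
      (Real.log_le_log (by positivity) hn3)]
    simp
  rw [htsum, ← Finset.sum_range_add_sum_Ico _ (by omega : ⌊x⌋₊ + 1 ≤ N + 1), hlow, sub_add_cancel_left,
    norm_neg]
  have hle : ∀ n ∈ Finset.Ico (⌊x⌋₊ + 1) (N + 1),
      ‖a n * (trapezoid (Real.log x) η (Real.log n) : ℝ)‖ ≤ 1 := fun n _ ↦ by
    obtain rfl | rfl | hn2 := hcases n
    · simp [ha0]
    · simp [ha1]
    obtain ⟨h1, h2, -⟩ := trapezoid_nonneg_le_one (β := Real.log x) hη0 (hlog hn2)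
    rw [norm_mul, norm_real, Real.norm_of_nonneg h1]
    exact mul_le_one₀ (ha n) h1 h2
  refine (norm_sum_le_of_le _ hle).trans ?_
  rw [Finset.sum_const, Nat.card_Ico, nsmul_eq_mul, mul_one, Nat.add_sub_add_right,
    Nat.cast_sub hxN]
  have h1 : (N : ℝ) ≤ x * Real.exp η := Nat.floor_le (by positivity)
  have h2 := Nat.sub_one_lt_floor x
  have h3 : Real.exp η - 1 ≤ 2 * η := by
    have := Real.abs_exp_sub_one_le (x := η) (by rw [abs_of_pos hη0]; linarith)
    rw [abs_of_pos hη0] at this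
    exact (le_abs_self _).trans this
  have h4 : x * (2 * η) = √x := by
    rw [hη]
    have := Real.sq_sqrt (by linarith : 0 ≤ x)
    field_simp
    linarith
  have h5 := mul_le_mul_of_nonneg_left h3 (by linarith : 0 ≤ x)
  linarith

theorem norm_LSeries_le_of_three_halves_le {a : ℕ → ℂ} (ha : ∀ n, ‖a n‖ ≤ 1) {s : ℂ}
    (hs : 3 / 2 ≤ s.re) : ‖LSeries a s‖ ≤ ∑' n : ℕ, 1 / (n : ℝ) ^ (3 / 2 : ℝ) := by
  refine tsum_of_norm_bounded (Real.summable_one_div_nat_rpow.mpr (by norm_num)).hasSum fun n ↦ ?_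
  rw [LSeries.norm_term_eq]
  split_ifs with h
  · positivity
  · have : (1 : ℝ) ≤ n := by exact_mod_cast Nat.one_le_iff_ne_zero.mpr h
    gcongr
    exact ha n

/-- Borel–Carathéodory: a logarithmic upper bound for `Re f` bounds `f` polynomially. -/
theorem exists_norm_le_of_re_le_log {f : ℂ → ℂ} {k B σ : ℝ} (hk : 1 ≤ k) (hσ : 1 / 2 < σ)
    (hf : DifferentiableOn ℂ f {s | 1 / 2 < s.re})
    (hre : ∀ s : ℂ, 1 / 2 < s.re → (f s).re ≤ Real.log (k * ‖s‖))
    (hB : ∀ s : ℂ, 3 / 2 ≤ s.re → ‖f s‖ ≤ B) :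
    ∃ C, ∀ s : ℂ, σ ≤ s.re → ‖f s‖ ≤ C * (1 + ‖s‖) ^ (1 / 2 : ℝ) := by
  have hB0 : 0 ≤ B := (norm_nonneg _).trans (hB 2 (by norm_num))
  have hσ' : 0 < σ - 1 / 2 := by linarith
  refine ⟨B + 3 * (Real.log k + 4 + B) / (σ - 1 / 2), fun s hs ↦ ?_⟩
  have hlogk : 0 ≤ Real.log k := Real.log_nonneg hk
  have hpow : 1 ≤ (1 + ‖s‖) ^ (1 / 2 : ℝ) :=
    Real.one_le_rpow (by linarith [norm_nonneg s]) (by norm_num)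
  rcases le_or_gt (3 / 2) s.re with h | h
  · refine (hB s h).trans ?_
    have : 0 ≤ 3 * (Real.log k + 4 + B) / (σ - 1 / 2) := by positivity
    nlinarith
  set w : ℂ := 2 + s.im * I with hw
  set M := Real.log (k * (4 * (1 + ‖s‖))) with hM
  have hM0 : 0 < M := Real.log_pos (by nlinarith [norm_nonneg s])
  have hws : s - w = ((s.re - 2 : ℝ) : ℂ) := by
    apply Complex.ext <;> simp [hw]
  have hnz : ‖s - w‖ = 2 - s.re := by
    rw [hws, norm_real, Real.norm_eq_abs, abs_of_neg (by linarith)]; ring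
  have hball {z : ℂ} (hz : z ∈ Metric.ball (0 : ℂ) (3 / 2)) : 1 / 2 < (w + z).re := by
    have h1 := (abs_re_le_norm z).trans_lt (by simpa using hz)
    have h2 := (abs_lt.mp h1).1
    simp [hw]; linarith
  have hbc := borelCaratheodory (f := fun z ↦ f (w + z)) (M := M) (R := 3 / 2) (z := s - w) hM0
    (hf.comp (by fun_prop) fun z hz ↦ hball hz) (fun z hz ↦ by
      refine (hre _ (hball hz)).trans (Real.log_le_log ?_ ?_)
      · refine mul_pos (by linarith) (norm_pos_iff.mpr fun h0 ↦ ?_)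
        have := hball hz
        rw [h0] at this; norm_num at this
      · have h1 : ‖z‖ < 3 / 2 := by simpa using hz
        have h2 : ‖w + z‖ ≤ ‖s‖ + ‖s - w‖ + ‖z‖ := by
          calc ‖w + z‖ = ‖s - (s - w) + z‖ := by ring_nf
            _ ≤ _ := (norm_add_le _ _).trans (by gcongr; exact norm_sub_le _ _)
        gcongr
        linarith [norm_nonneg s]) (by norm_num) (by
      rw [mem_ball_zero_iff, hnz]; linarith)
  simp only [add_sub_cancel, add_zero, hnz] at hbc
  have hMle : M ≤ (Real.log k + 4) * (1 + ‖s‖) ^ (1 / 2 : ℝ) := by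
    have h1 := Real.log_le_rpow_div (by positivity : 0 ≤ 4 * (1 + ‖s‖))
      (show (0 : ℝ) < 1 / 2 by norm_num)
    rw [Real.mul_rpow (by norm_num) (by positivity), ← Real.sqrt_eq_rpow 4,
      show √(4 : ℝ) = 2 by rw [show (4 : ℝ) = 2 ^ 2 by norm_num]; simp] at h1
    rw [hM, Real.log_mul (by positivity) (by positivity)]
    nlinarith
  have hw2 : ‖f w‖ ≤ B := hB w (by simp [hw]; norm_num)
  have hden : σ - 1 / 2 ≤ 3 / 2 - (2 - s.re) := by linarith
  calc _ ≤ 2 * M * (2 - s.re) / (3 / 2 - (2 - s.re)) +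
        ‖f w‖ * (3 / 2 + (2 - s.re)) / (3 / 2 - (2 - s.re)) := hbc
    _ ≤ 2 * M * (3 / 2) / (σ - 1 / 2) + B * 3 / (σ - 1 / 2) := by
        gcongr <;> linarith
    _ = 3 * (M + B) / (σ - 1 / 2) := by ring
    _ ≤ 3 * ((Real.log k + 4 + B) * (1 + ‖s‖) ^ (1 / 2 : ℝ)) / (σ - 1 / 2) := by
        gcongr
        nlinarith
    _ = 3 * (Real.log k + 4 + B) / (σ - 1 / 2) * (1 + ‖s‖) ^ (1 / 2 : ℝ) := by ring
    _ ≤ _ := by gcongr; linarith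

/-- Partial sums of a bounded sequence whose Dirichlet series continues to `Re s > 1/2`, with
logarithmically bounded real part, have square root cancellation. -/
theorem exists_norm_sum_le_of_LSeries_re_le_log : ∃ A, 0 < A ∧ ∀ (a : ℕ → ℂ) (f : ℂ → ℂ) (k x : ℝ),
    (∀ n, ‖a n‖ ≤ 1) → a 0 = 0 → a 1 = 0 → 1 ≤ k → 2 ≤ x →
    DifferentiableOn ℂ f {s | 1 / 2 < s.re} →
    (∀ s : ℂ, 1 < s.re → f s = LSeries a s) →
    (∀ s : ℂ, 1 / 2 < s.re → (f s).re ≤ Real.log (k * ‖s‖)) →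
    ‖∑ n ∈ Finset.range (⌊x⌋₊ + 1), a n‖ ≤ A * √x * Real.log x * Real.log (2 * k * x) := by
  set B : ℝ := ∑' n : ℕ, 1 / (n : ℝ) ^ (3 / 2 : ℝ) with hB
  set E := 480 * (12 * Real.pi + 2 * (∫ t : ℝ, Real.log (1 + |t|) * halfPlanePoisson 1 t) +
        2 * Real.pi * B) with hE
  have hB0 : 0 ≤ B := tsum_nonneg fun n ↦ by positivity
  have hI0 : 0 ≤ ∫ t : ℝ, Real.log (1 + |t|) * halfPlanePoisson 1 t := integral_nonneg fun t ↦
    mul_nonneg (Real.log_nonneg (by linarith [abs_nonneg t])) (halfPlanePoisson_nonneg one_pos t)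
  have hE0 : 0 < E := by positivity
  refine ⟨E + 4, by positivity, fun a f k x ha ha0 ha1 hk hx hf hfL hre ↦ ?_⟩
  have hlog2 := Real.log_two_gt_d9
  have hlog : Real.log 2 ≤ Real.log x := Real.log_le_log (by norm_num) hx
  have hlog0 : 0 < Real.log x := by linarith
  have hinv : 0 < 1 / Real.log x := one_div_pos.mpr hlog0
  have hinv2 : 1 / Real.log x ≤ 3 / 2 := by
    rw [div_le_div_iff₀ (by linarith) (by norm_num)]; linarith
  have hsq : 1.4 ≤ √x := Real.le_sqrt_of_sq_le (by linarith)
  have hη : 0 ≤ 1 / (2 * √x) := by positivity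
  set σ := 1 / 2 + 1 / Real.log x with hσ
  have hfB (s : ℂ) (hs : 3 / 2 ≤ s.re) : ‖f s‖ ≤ B := by
    rw [hfL s (by linarith)]
    exact norm_LSeries_le_of_three_halves_le ha hs
  obtain ⟨C, hC⟩ := exists_norm_le_of_re_le_log hk (by linarith : 1 / 2 < σ) hf hre hfB
  have hfσ : DifferentiableOn ℂ f {s | σ ≤ s.re} :=
    hf.mono fun s (hs : σ ≤ s.re) ↦ show 1 / 2 < s.re by linarith
  have hmain := norm_integral_mul_trapezoidKernel_le hx (by linarith : 2 ≤ 2 * k) hfσ hC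
    (fun t ↦ by
      have h1 : 1 / 2 < ((σ : ℂ) + t * I).re := by simp; linarith
      refine (hre _ h1).trans (Real.log_le_log ?_ ?_)
      · exact mul_pos (by linarith)
          (lt_of_lt_of_le (by linarith) (re_le_norm ((σ : ℂ) + t * I)))
      · have h2 : ‖(σ : ℂ) + t * I‖ ≤ σ + |t| := by
          refine (norm_add_le _ _).trans ?_
          rw [norm_mul, norm_I, norm_real, norm_real, mul_one, Real.norm_eq_abs, Real.norm_eq_abs,
            abs_of_pos (by linarith : 0 < σ)]
        rw [mul_comm 2 k, mul_assoc]
        gcongr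
        linarith [abs_nonneg t]) hfB
  rw [integral_mul_trapezoidKernel_eq_of_le hlog0.le hη (by linarith : σ ≤ 3) hfσ hC] at hmain
  have hL3 (t : ℝ) : f ((3 : ℝ) + t * I) = LSeries a ((3 : ℝ) + t * I) := hfL _ (by simp)
  simp_rw [hL3] at hmain
  rw [integral_LSeries_mul_trapezoidKernel ha ha0 (by norm_num) hlog0.le hη, norm_mul] at hmain
  have hpi : 1 ≤ ‖(2 * Real.pi : ℂ)‖ := by
    rw [norm_mul, norm_real, Complex.norm_ofNat, Real.norm_of_nonneg Real.pi_pos.le]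
    linarith [Real.pi_gt_three]
  have hcut := norm_sum_sub_tsum_trapezoid_le ha ha0 ha1 hx
  set S := ∑' n, a n * (trapezoid (Real.log x) (1 / (2 * √x)) (Real.log n) : ℝ)
  have hS : ‖S‖ ≤ E * √x * Real.log x * Real.log (2 * k * x) :=
    (le_mul_of_one_le_left (norm_nonneg _) hpi).trans hmain
  have hL1 : 2 * Real.log 2 ≤ Real.log (2 * k * x) := by
    have := Real.log_le_log (by norm_num) (by nlinarith : (2 : ℝ) ^ 2 ≤ 2 * k * x)
    rwa [Real.log_pow] at this
  have hprod : 1 / 2 ≤ Real.log x * Real.log (2 * k * x) := by nlinarith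
  calc _ = ‖(∑ n ∈ Finset.range (⌊x⌋₊ + 1), a n - S) + S‖ := by rw [sub_add_cancel]
    _ ≤ (√x + 1) + E * √x * Real.log x * Real.log (2 * k * x) :=
        (norm_add_le _ _).trans (add_le_add hcut hS)
    _ ≤ 4 * √x * (Real.log x * Real.log (2 * k * x)) +
          E * √x * Real.log x * Real.log (2 * k * x) := by
        gcongr
        nlinarith
    _ = _ := by ring

theorem DirichletCharacter.sum_range_add_eq_zero {N : ℕ} [NeZero N] {χ : DirichletCharacter ℂ N}
    (hχ : χ ≠ 1) (m : ℕ) : ∑ i ∈ Finset.range N, χ ((m + i : ℕ) : ZMod N) = 0 := by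
  rw [← MulChar.sum_eq_zero_of_ne_one hχ, ← Equiv.sum_comp (Equiv.addLeft (m : ZMod N)) fun a ↦ χ a]
  refine Finset.sum_nbij' (fun i ↦ (i : ZMod N)) ZMod.val (by simp)
    (fun a _ ↦ by simpa using ZMod.val_lt a)
    (fun i hi ↦ ZMod.val_cast_of_lt (by simpa using hi)) (by simp) (by simp)

/-- Trivial bound for incomplete character sums. -/
theorem DirichletCharacter.norm_sum_range_add_le {N : ℕ} [NeZero N] {χ : DirichletCharacter ℂ N}
    (hχ : χ ≠ 1) (m n : ℕ) : ‖∑ i ∈ Finset.range n, χ ((m + i : ℕ) : ZMod N)‖ ≤ N := by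
  induction n using Nat.strong_induction_on generalizing m with
  | _ n ih =>
    rcases le_or_gt n N with h | h
    · refine (norm_sum_le_of_le _ fun i _ ↦ χ.norm_le_one _).trans ?_
      simpa using h
    · obtain ⟨k, rfl⟩ := Nat.exists_eq_add_of_lt h
      rw [add_assoc, Finset.sum_range_add, sum_range_add_eq_zero hχ, zero_add]
      simpa only [← add_assoc] using ih (k + 1) (by have := NeZero.pos N; omega) (m + N)

theorem DirichletCharacter.norm_sum_Icc_one_le {N : ℕ} [NeZero N] {χ : DirichletCharacter ℂ N}
    (hχ : χ ≠ 1) (n : ℕ) : ‖∑ k ∈ Finset.Icc 1 n, χ (k : ZMod N)‖ ≤ N := by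
  rw [← Finset.Ico_add_one_right_eq_Icc, Finset.sum_Ico_eq_sum_range]
  exact norm_sum_range_add_le hχ 1 _

theorem norm_integral_Ioi_mul_cpow_le {S : ℝ → ℂ} {M : ℝ} (hS : ∀ t, ‖S t‖ ≤ M) {s : ℂ}
    (hs : 0 < s.re) : ‖∫ t in Ioi (1 : ℝ), S t * (t : ℂ) ^ (-(s + 1))‖ ≤ M / s.re := by
  have hi : IntegrableOn (fun t : ℝ ↦ t ^ (-(s.re + 1))) (Ioi 1) :=
    integrableOn_Ioi_rpow_of_lt (by linarith) one_pos
  have hle := norm_integral_le_of_norm_le (hi.const_mul M)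
    (f := fun t ↦ S t * (t : ℂ) ^ (-(s + 1))) ?_
  · rwa [integral_const_mul, integral_Ioi_rpow_of_lt (by linarith) one_pos, Real.one_rpow,
      show -(s.re + 1) + 1 = -s.re by ring, neg_div_neg_eq, mul_one_div] at hle
  · filter_upwards [ae_restrict_mem measurableSet_Ioi] with t ht
    have ht0 : 0 < t := one_pos.trans ht
    rw [norm_mul, norm_cpow_eq_rpow_re_of_pos ht0]
    simp only [neg_re, add_re, one_re]
    gcongr
    exact hS t

/-- The representation of `L(s, χ)` by Abel summation. -/
theorem DirichletCharacter.LFunction_eq_mul_integral {N : ℕ} [NeZero N]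
    {χ : DirichletCharacter ℂ N} (hχ : χ ≠ 1) {s : ℂ} (hs : 0 < s.re) :
    LFunction χ s =
      s * ∫ t in Ioi (1 : ℝ), (∑ k ∈ Finset.Icc 1 ⌊t⌋₊, χ (k : ZMod N)) * (t : ℂ) ^ (-(s + 1)) := by
  set S : ℝ → ℂ := fun t ↦ ∑ k ∈ Finset.Icc 1 ⌊t⌋₊, χ (k : ZMod N) with hS
  have hSb (t : ℝ) : ‖S t‖ ≤ N := norm_sum_Icc_one_le hχ _
  have hSm : Measurable S :=
    (measurable_from_top (f := fun n : ℕ ↦ ∑ k ∈ Finset.Icc 1 n, χ (k : ZMod N))).comp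
      Nat.measurable_floor
  set T : ℝ → ℂ := indicator (Ioi 1) S with hT
  have hTb (t : ℝ) : ‖T t‖ ≤ N := (norm_indicator_le_norm_self _ _).trans (hSb t)
  have hmellin (s : ℂ) : mellin T (-s) = ∫ t in Ioi (1 : ℝ), S t * (t : ℂ) ^ (-(s + 1)) := by
    rw [mellin, hT]
    have : ∀ t : ℝ, (t : ℂ) ^ (-s - 1) • indicator (Ioi 1) S t =
        indicator (Ioi 1) (fun t ↦ S t * (t : ℂ) ^ (-(s + 1))) t := fun t ↦ by
      by_cases ht : t ∈ Ioi (1 : ℝ)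
      · rw [indicator_of_mem ht, indicator_of_mem ht, smul_eq_mul, mul_comm, neg_add']
      · simp [indicator_of_notMem ht]
    simp_rw [this]
    rw [setIntegral_indicator measurableSet_Ioi, inter_eq_self_of_subset_right]
    exact Ioi_subset_Ioi zero_le_one
  have hdiff {s : ℂ} (hs : 0 < s.re) : DifferentiableAt ℂ (fun s ↦ s * mellin T (-s)) s := by
    suffices DifferentiableAt ℂ (mellin T) (-s) from
      differentiableAt_id.mul (this.comp s differentiableAt_id.neg)
    refine mellin_differentiableAt_of_isBigO_rpow (a := 0) (b := (-s).re - 1) ?_ ?_ (by simpa) ?_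
      (by simp)
    · refine LocallyIntegrable.locallyIntegrableOn ?_ _
      refine (locallyIntegrable_const (N : ℝ)).mono
        (hSm.indicator measurableSet_Ioi).aestronglyMeasurable (.of_forall fun t ↦ ?_)
      rw [Real.norm_of_nonneg (by positivity)]
      exact hTb t
    · refine Asymptotics.IsBigO.of_bound N (.of_forall fun t ↦ ?_)
      simpa using hTb t
    · refine (Asymptotics.isBigO_zero _ _).congr' ?_ .rfl
      filter_upwards [Ioo_mem_nhdsGT one_pos] with t ht
      exact (indicator_of_notMem (fun h : 1 < t ↦ ht.2.not_gt h) _).symm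
  have hopen : IsOpen {s : ℂ | 0 < s.re} := isOpen_lt continuous_const continuous_re
  have h1 : AnalyticOnNhd ℂ (LFunction χ) {s | 0 < s.re} :=
    (differentiable_LFunction hχ).differentiableOn.analyticOnNhd hopen
  have h2 : AnalyticOnNhd ℂ (fun s ↦ s * mellin T (-s)) {s | 0 < s.re} :=
    DifferentiableOn.analyticOnNhd (fun s hs ↦ (hdiff hs).differentiableWithinAt) hopen
  have hpre : IsPreconnected {s : ℂ | 0 < s.re} := (convex_halfSpace_re_gt 0).isPreconnected
  have heq := h1.eqOn_of_preconnected_of_eventuallyEq h2 hpre (z₀ := 2) (by simp) (by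
    filter_upwards [(isOpen_lt continuous_const continuous_re).mem_nhds
      (show (1 : ℝ) < (2 : ℂ).re by simp)] with z (hz : 1 < z.re)
    rw [LFunction_eq_LSeries χ hz, hmellin, LSeries_eq_mul_integral _ le_rfl (by linarith)
      (LSeriesSummable_of_one_lt_re χ hz)]
    refine Asymptotics.IsBigO.of_bound N (.of_forall fun n ↦ ?_)
    simpa using norm_sum_Icc_one_le hχ n)
  rw [heq hs]
  simp only [hmellin, hS]

theorem DirichletCharacter.norm_LFunction_le {N : ℕ} [NeZero N]
    {χ : DirichletCharacter ℂ N} (hχ : χ ≠ 1) {s : ℂ} (hs : 0 < s.re) :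
    ‖LFunction χ s‖ ≤ N * ‖s‖ / s.re := by
  rw [LFunction_eq_mul_integral hχ hs, norm_mul]
  refine (mul_le_mul_of_nonneg_left (norm_integral_Ioi_mul_cpow_le
    (fun t ↦ norm_sum_Icc_one_le hχ ⌊t⌋₊) hs) (norm_nonneg s)).trans_eq ?_
  ring

/-- A continuous logarithm of a holomorphic function is holomorphic. -/
theorem ContinuousOn.differentiableOn_of_exp_eqOn {f g : ℂ → ℂ} {U : Set ℂ} (hU : IsOpen U)
    (hf : ContinuousOn f U) (hg : DifferentiableOn ℂ g U) (h : EqOn (fun z ↦ exp (f z)) g U) :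
    DifferentiableOn ℂ f U := by
  intro z hz
  have hUz := hU.mem_nhds hz
  have hgz := hg.differentiableAt hUz
  have hgz0 : g z ≠ 0 := by rw [← h hz]; exact exp_ne_zero _
  have hc : ContinuousAt (fun w ↦ (f w - f z).im) z :=
    continuous_im.continuousAt.comp ((hf.continuousAt hUz).sub continuousAt_const)
  have hlog : DifferentiableAt ℂ (fun w ↦ f z + Complex.log (g w / g z)) z :=
    ((hgz.div_const _).clog (by simp [div_self hgz0])).const_add _
  refine (hlog.congr_of_eventuallyEq ?_).differentiableWithinAt
  have h0 : (f z - f z).im ∈ Ioo (-Real.pi) Real.pi := by simp [Real.pi_pos]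
  filter_upwards [hUz, hc.preimage_mem_nhds (Ioo_mem_nhds h0.1 h0.2)] with w hw hw'
  rw [← h hw, ← h hz, ← exp_sub, log_exp hw'.1 hw'.2.le]
  ring

theorem Convex.isSimplyConnected {U : Set ℂ} (hU : Convex ℝ U) (hne : U.Nonempty) :
    IsSimplyConnected U := by
  have := hU.contractibleSpace hne
  exact (inferInstance : SimplyConnectedSpace U)

/-- The coefficients of the Dirichlet series of `log L(s, χ)`. -/
noncomputable def DirichletCharacter.logCoeff {N : ℕ} (χ : DirichletCharacter ℂ N) (n : ℕ) : ℂ :=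
  χ (n : ZMod N) * (ArithmeticFunction.vonMangoldt n : ℝ) / (Real.log n : ℝ)

theorem DirichletCharacter.norm_logCoeff_le {N : ℕ} (χ : DirichletCharacter ℂ N) (n : ℕ) :
    ‖χ.logCoeff n‖ ≤ ArithmeticFunction.vonMangoldt n / Real.log n := by
  have hlog : 0 ≤ Real.log n := Real.log_natCast_nonneg n
  have hΛ : 0 ≤ ArithmeticFunction.vonMangoldt n := ArithmeticFunction.vonMangoldt_nonneg
  rw [logCoeff, norm_div, norm_mul, norm_real, norm_real, Real.norm_of_nonneg hlog,
    Real.norm_of_nonneg hΛ]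
  gcongr
  exact mul_le_of_le_one_left hΛ (χ.norm_le_one _)

theorem DirichletCharacter.norm_logCoeff_le_one {N : ℕ} (χ : DirichletCharacter ℂ N) (n : ℕ) :
    ‖χ.logCoeff n‖ ≤ 1 :=
  (χ.norm_logCoeff_le n).trans
    (div_le_one_of_le₀ ArithmeticFunction.vonMangoldt_le_log (Real.log_natCast_nonneg n))

theorem DirichletCharacter.logCoeff_prime {N : ℕ} (χ : DirichletCharacter ℂ N) {q : ℕ}
    (hq : q.Prime) : χ.logCoeff q = χ (q : ZMod N) := by
  have : Real.log q ≠ 0 := (Real.log_pos (by exact_mod_cast hq.one_lt)).ne'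
  rw [logCoeff, ArithmeticFunction.vonMangoldt_apply_prime hq, mul_div_assoc,
    div_self (by exact_mod_cast this), mul_one]

/-- If `L(s, χ)` has no zeros in `Re s > 1/2`, it has a holomorphic logarithm there, which is given
by the usual Dirichlet series for `Re s > 1`. -/
theorem DirichletCharacter.exists_log_LFunction {N : ℕ} [NeZero N] {χ : DirichletCharacter ℂ N}
    (hχ : χ ≠ 1) (hnz : ∀ s : ℂ, 1 / 2 < s.re → LFunction χ s ≠ 0) :
    ∃ f : ℂ → ℂ, DifferentiableOn ℂ f {s | 1 / 2 < s.re} ∧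
      (∀ s : ℂ, 1 < s.re → f s = LSeries χ.logCoeff s) ∧
      ∀ s : ℂ, 1 / 2 < s.re → exp (f s) = LFunction χ s := by
  have hopen (b : ℝ) : IsOpen {s : ℂ | b < s.re} := isOpen_lt continuous_const continuous_re
  have hL : Differentiable ℂ (LFunction χ) := differentiable_LFunction hχ
  obtain ⟨f, hfc, hf⟩ := exists_continuousOn_eqOn_exp_comp (U := {s : ℂ | 1 / 2 < s.re})
    (g := LFunction χ)
    ((convex_halfSpace_re_gt _).isSimplyConnected ⟨1, by norm_num⟩)
    (hopen _) hL.continuous.continuousOn (by rintro ⟨s, hs, h⟩; exact hnz s hs h)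
  have hfd := hfc.differentiableOn_of_exp_eqOn (hopen _) hL.differentiableOn hf
  have hLd {s : ℂ} (hs : 1 < s.re) : DifferentiableAt ℂ (LSeries χ.logCoeff) s :=
    (LSeries_hasDerivAt ((LSeries.abscissaOfAbsConv_le_of_le_const
      ⟨1, fun n _ ↦ χ.norm_logCoeff_le_one n⟩).trans_lt (by exact_mod_cast hs))).differentiableAt
  have hexp {s : ℂ} (hs : 1 < s.re) : exp (f s - LSeries χ.logCoeff s) = 1 := by
    have h1 : exp (f s) = LFunction χ s := hf (show 1 / 2 < s.re by linarith)
    have h2 : exp (LSeries χ.logCoeff s) = LFunction χ s := by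
      rw [LFunction_eq_LSeries χ hs]; exact LSeries_eq_exp_LSeries χ hs
    rw [exp_sub, h1, h2, div_self (hnz s (by linarith))]
  have hdd {s : ℂ} (hs : 1 < s.re) : DifferentiableAt ℂ (fun s ↦ f s - LSeries χ.logCoeff s) s :=
    (hfd.differentiableAt ((hopen _).mem_nhds (show 1 / 2 < s.re by linarith))).sub (hLd hs)
  obtain ⟨c, hc⟩ := (hopen 1).exists_is_const_of_deriv_eq_zero
    (convex_halfSpace_re_gt 1).isPreconnected
    (fun s hs ↦ (hdd hs).differentiableWithinAt) (fun s (hs : 1 < s.re) ↦ by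
      have h1 := (hdd hs).hasDerivAt.cexp
      have h2 : HasDerivAt (fun s ↦ exp (f s - LSeries χ.logCoeff s)) 0 s :=
        (hasDerivAt_const s (1 : ℂ)).congr_of_eventuallyEq (by
          filter_upwards [(hopen 1).mem_nhds hs] with z hz using hexp hz)
      simpa using h1.unique h2)
  have hc1 : exp c = 1 := by
    rw [← hc 2 (by simp)]; exact hexp (by simp)
  refine ⟨fun s ↦ f s - c, hfd.sub_const c, fun s hs ↦ ?_, fun s hs ↦ ?_⟩
  · have := hc s hs
    simp only [← this, sub_sub_cancel]
  · rw [exp_sub, hc1, div_one]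
    exact hf hs

/-- The prime powers contribute little to the summatory function of the coefficients of
`log L(s, χ)`. -/
theorem DirichletCharacter.norm_sum_primes_sub_sum_logCoeff_le {N : ℕ} (χ : DirichletCharacter ℂ N)
    {x : ℝ} (hx : 2 ≤ x) :
    ‖∑ n ∈ Finset.range (⌊x⌋₊ + 1), χ.logCoeff n -
      ∑ q ∈ Finset.Iic ⌊x⌋₊ with q.Prime, χ (q : ZMod N)‖ ≤ 4 * √x * Real.log x := by
  have hset : Finset.range (⌊x⌋₊ + 1) = Finset.Iic ⌊x⌋₊ := by ext; simp
  have hlog2 := Real.log_two_gt_d9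
  rw [hset, ← Finset.sum_filter_add_sum_filter_not (Finset.Iic ⌊x⌋₊) Nat.Prime χ.logCoeff,
    Finset.sum_congr rfl fun q hq ↦ χ.logCoeff_prime (Finset.mem_filter.mp hq).2,
    add_sub_cancel_left]
  have hle (n : ℕ) : ‖χ.logCoeff n‖ ≤ (Real.log 2)⁻¹ * ArithmeticFunction.vonMangoldt n := by
    refine (χ.norm_logCoeff_le n).trans ?_
    obtain rfl | rfl | hn : n = 0 ∨ n = 1 ∨ 2 ≤ n := by omega
    · simp
    · simp
    · have hn' := Real.log_le_log two_pos (by exact_mod_cast hn : (2 : ℝ) ≤ n)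
      have := ArithmeticFunction.vonMangoldt_nonneg (n := n)
      rw [div_eq_inv_mul]
      gcongr
  have hsub := Chebyshev.psi_sub_theta_le (by linarith : 1 ≤ x)
  rw [Chebyshev.psi_sub_theta_eq_sum_not_prime] at hsub
  have heq : ∑ n ∈ Finset.Iic ⌊x⌋₊ with ¬n.Prime, ArithmeticFunction.vonMangoldt n =
      ∑ n ∈ Finset.Ioc 0 ⌊x⌋₊ with ¬n.Prime, ArithmeticFunction.vonMangoldt n := by
    symm
    refine Finset.sum_subset (Finset.filter_subset_filter _ fun n ↦ by simp) fun n hn hn' ↦ ?_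
    obtain rfl | h := Nat.eq_zero_or_pos n
    · simp
    · simp_all
  refine (norm_sum_le_of_le _ fun n _ ↦ hle n).trans ?_
  rw [← Finset.mul_sum, heq, inv_mul_le_iff₀ (by linarith)]
  refine hsub.trans ?_
  have : 0 ≤ √x * Real.log x := mul_nonneg (Real.sqrt_nonneg x) (Real.log_nonneg (by linarith))
  nlinarith

end VerticalLines

/-- Conditional bound on character sums over primes: if GRH holds for the nonprincipal
Dirichlet character `χ` mod `p`, then `|∑_{q ≤ x prime} χ(q)| ≤ C √x (log(px))²`. -/
theorem char_sum_over_primes_GRH :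
    ∃ C : ℝ, 0 < C ∧ ∀ (p : ℕ) [Fact p.Prime],
      ∀ χ : DirichletCharacter ℂ p, χ ≠ 1 →
      (∀ s : ℂ, DirichletCharacter.LFunction χ s = 0 → 0 < s.re → s.re < 1 → s.re = 1/2) →
      ∀ x : ℝ, 2 ≤ x →
        ‖∑ q ∈ Finset.Iic ⌊x⌋₊ |>.filter Nat.Prime, χ (q : ZMod p)‖
          ≤ C * x ^ ((1 : ℝ)/2) * (Real.log ((p : ℝ) * x)) ^ 2 := by
  obtain ⟨A, hA, hmain⟩ := exists_norm_sum_le_of_LSeries_re_le_log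
  refine ⟨2 * A + 4, by positivity, fun p hp χ hχ hGRH x hx ↦ ?_⟩
  have hp2 : (2 : ℝ) ≤ p := by exact_mod_cast hp.out.two_le
  have hnz (s : ℂ) (hs : 1 / 2 < s.re) : DirichletCharacter.LFunction χ s ≠ 0 := fun h0 ↦ by
    rcases le_or_gt 1 s.re with h1 | h1
    · exact DirichletCharacter.LFunction_ne_zero_of_one_le_re χ (.inl hχ) h1 h0
    · exact hs.ne' (hGRH s h0 (by linarith) h1)
  obtain ⟨f, hfd, hfL, hfe⟩ := DirichletCharacter.exists_log_LFunction hχ hnz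
  have hre (s : ℂ) (hs : 1 / 2 < s.re) : (f s).re ≤ Real.log (2 * p * ‖s‖) := by
    have hs0 : 0 < s.re := by linarith
    have hns : 0 < ‖s‖ := hs0.trans_le (Complex.re_le_norm s)
    rw [Real.le_log_iff_exp_le (by positivity), ← Complex.norm_exp, hfe s hs]
    refine (DirichletCharacter.norm_LFunction_le hχ hs0).trans ?_
    rw [div_le_iff₀ hs0]
    have : 0 < p * ‖s‖ := by positivity
    nlinarith
  have h1 := hmain χ.logCoeff f (2 * p) x χ.norm_logCoeff_le_one
    (by simp [DirichletCharacter.logCoeff]) (by simp [DirichletCharacter.logCoeff])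
    (by linarith) hx hfd hfL hre
  have h2 := χ.norm_sum_primes_sub_sum_logCoeff_le hx
  have hpx : 4 ≤ p * x := by nlinarith
  have hlx : 0 ≤ Real.log x := Real.log_nonneg (by linarith)
  have hxl : Real.log x ≤ Real.log (p * x) := Real.log_le_log (by linarith) (by nlinarith)
  have hl1 : 1 ≤ Real.log (p * x) := by
    have h4 := Real.log_le_log (by norm_num) (by linarith : (2 : ℝ) ^ 2 ≤ p * x)
    rw [Real.log_pow] at h4
    have := Real.log_two_gt_d9
    push_cast at h4
    linarith
  have hl2 : Real.log (2 * (2 * p) * x) ≤ 2 * Real.log (p * x) := by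
    have h5 : Real.log ((p * x) ^ 2) = 2 * Real.log (p * x) := by rw [Real.log_pow]; norm_num
    rw [← h5]
    exact Real.log_le_log (by positivity) (by nlinarith)
  have hl3 : 0 ≤ Real.log (2 * (2 * p) * x) := Real.log_nonneg (by nlinarith)
  rw [← Real.sqrt_eq_rpow]
  calc _ ≤ A * √x * Real.log x * Real.log (2 * (2 * p) * x) + 4 * √x * Real.log x := by
        rw [← sub_sub_cancel (∑ n ∈ Finset.range (⌊x⌋₊ + 1), χ.logCoeff n)
          (∑ q ∈ Finset.Iic ⌊x⌋₊ with q.Prime, χ (q : ZMod p))]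
        exact (norm_sub_le _ _).trans (add_le_add h1 h2)
    _ ≤ A * √x * Real.log (p * x) * (2 * Real.log (p * x)) +
          4 * √x * (Real.log (p * x) * Real.log (p * x)) := by
        gcongr
        nlinarith
    _ = _ := by ring
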